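/- arXiv:1106.4972 — 2 statements merged into one kernel-verified Lean document; each statement's English description precedes it below -/
import Mathlib

section
/- Let R be a commutative Noetherian ring with a dualizing complex and M a nonzero finitely generated G–Gorenstein R-module. Then for every finitely generated R-module N of finite injective dimension or finite projective dimension, Ext_R^i(Ext_R^j(N, M), M) = 0 for all integers i, j with 0 ≤ i < j. -/
universe u

namespace GG

open RingTheory.Sequence

variable (R : Type u) [CommRing R]

/-- A module `N` is Gorenstein injective if it is a kernel in a `Hom(Inj,−)`-exact exact
doubly infinite complex of injective modules. -/
def IsGorensteinInjective (N : Type u) [AddCommGroup N] [Module R N] : Prop :=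
  ∃ (X : ℤ → ModuleCat.{u} R) (d : ∀ n : ℤ, X n →ₗ[R] X (n + 1)),
    (∀ n, Module.Injective R (X n)) ∧
    (∀ n, LinearMap.range (d n) = LinearMap.ker (d (n + 1))) ∧
    (∀ (I : ModuleCat.{u} R), Module.Injective R I →
      ∀ (n : ℤ) (φ : I →ₗ[R] X (n + 1)), (d (n + 1)).comp φ = 0 →
        ∃ ψ : I →ₗ[R] X n, (d n).comp ψ = φ) ∧
    Nonempty (N ≃ₗ[R] LinearMap.ker (d 0))

/-- A module `N` is Gorenstein projective if it is a kernel in a `Hom(−,Proj)`-exact exact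
doubly infinite complex of projective modules. -/
def IsGorensteinProjective (N : Type u) [AddCommGroup N] [Module R N] : Prop :=
  ∃ (X : ℤ → ModuleCat.{u} R) (d : ∀ n : ℤ, X n →ₗ[R] X (n + 1)),
    (∀ n, Module.Projective R (X n)) ∧
    (∀ n, LinearMap.range (d n) = LinearMap.ker (d (n + 1))) ∧
    (∀ (P : ModuleCat.{u} R), Module.Projective R P →
      ∀ (n : ℤ) (φ : X (n + 1) →ₗ[R] P), φ.comp (d n) = 0 →
        ∃ ψ : X (n + 1 + 1) →ₗ[R] P, ψ.comp (d (n + 1)) = φ) ∧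
    Nonempty (N ≃ₗ[R] LinearMap.ker (d 0))

/-- A module `N` is Gorenstein flat if it is a kernel in an `(Inj ⊗ −)`-exact exact
doubly infinite complex of flat modules. -/
def IsGorensteinFlat (N : Type u) [AddCommGroup N] [Module R N] : Prop :=
  ∃ (X : ℤ → ModuleCat.{u} R) (d : ∀ n : ℤ, X n →ₗ[R] X (n + 1)),
    (∀ n, Module.Flat R (X n)) ∧
    (∀ n, LinearMap.range (d n) = LinearMap.ker (d (n + 1))) ∧
    (∀ (I : ModuleCat.{u} R), Module.Injective R I →
      ∀ n : ℤ, LinearMap.range (LinearMap.lTensor (R := R) I (d n)) =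
        LinearMap.ker (LinearMap.lTensor (R := R) I (d (n + 1)))) ∧
    Nonempty (N ≃ₗ[R] LinearMap.ker (d 0))

/-- Existence of a right resolution of length `≤ n` by modules satisfying `P`. -/
def CoresolutionLE (P : ModuleCat.{u} R → Prop) (M : Type u) [AddCommGroup M] [Module R M]
    (n : ℕ) : Prop :=
  ∃ (G : ℕ → ModuleCat.{u} R) (d : ∀ i : ℕ, G i →ₗ[R] G (i + 1)) (ε : M →ₗ[R] G 0),
    (∀ i, P (G i)) ∧ Function.Injective ε ∧
    LinearMap.range ε = LinearMap.ker (d 0) ∧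
    (∀ i, LinearMap.range (d i) = LinearMap.ker (d (i + 1))) ∧
    (∀ i, n < i → ∀ x : G i, x = 0)

/-- Existence of a left resolution of length `≤ n` by modules satisfying `P`. -/
def ResolutionLE (P : ModuleCat.{u} R → Prop) (M : Type u) [AddCommGroup M] [Module R M]
    (n : ℕ) : Prop :=
  ∃ (G : ℕ → ModuleCat.{u} R) (d : ∀ i : ℕ, G (i + 1) →ₗ[R] G i) (ε : G 0 →ₗ[R] M),
    (∀ i, P (G i)) ∧ Function.Surjective ε ∧
    LinearMap.ker ε = LinearMap.range (d 0) ∧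
    (∀ i, LinearMap.ker (d i) = LinearMap.range (d (i + 1))) ∧
    (∀ i, n < i → ∀ x : G i, x = 0)

/-- `Gid_R M ≤ n`. -/
def gidLE (M : Type u) [AddCommGroup M] [Module R M] (n : ℕ) : Prop :=
  CoresolutionLE R (fun N => IsGorensteinInjective R N) M n

/-- `id_R M ≤ n`. -/
def idLE (M : Type u) [AddCommGroup M] [Module R M] (n : ℕ) : Prop :=
  CoresolutionLE R (fun N => Module.Injective R N) M n

/-- `pd_R M ≤ n`. -/
def pdLE (M : Type u) [AddCommGroup M] [Module R M] (n : ℕ) : Prop :=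
  ResolutionLE R (fun N => Module.Projective R N) M n

/-- `fd_R M ≤ n`. -/
def fdLE (M : Type u) [AddCommGroup M] [Module R M] (n : ℕ) : Prop :=
  ResolutionLE R (fun N => Module.Flat R N) M n

/-- `Gfd_R M ≤ n`. -/
def gfdLE (M : Type u) [AddCommGroup M] [Module R M] (n : ℕ) : Prop :=
  ResolutionLE R (fun N => IsGorensteinFlat R N) M n

/-- Gorenstein injective dimension, as an extended natural number. -/
noncomputable def gid (M : Type u) [AddCommGroup M] [Module R M] : ℕ∞ :=
  sInf {c : ℕ∞ | ∃ n : ℕ, c = n ∧ gidLE R M n}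

/-- The depth of a module over a local ring: the supremum of the lengths of regular
sequences contained in the maximal ideal. -/
noncomputable def mdepth [IsLocalRing R] (M : Type u) [AddCommGroup M] [Module R M] : ℕ∞ :=
  sSup {c : ℕ∞ | ∃ rs : List R, c = rs.length ∧
    (∀ r ∈ rs, r ∈ IsLocalRing.maximalIdeal R) ∧ RingTheory.Sequence.IsRegular M rs}

/-- The Krull dimension of a module: the Krull dimension of its support. -/
noncomputable def mdim (M : Type u) [AddCommGroup M] [Module R M] : WithBot ℕ∞ :=
  Order.krullDim ↥(Module.support R M)

/-- The height of a prime in the support of `M`. -/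
noncomputable def htM (M : Type u) [AddCommGroup M] [Module R M] (p : PrimeSpectrum R) : ℕ∞ :=
  ⨆ h : p ∈ Module.support R M, Order.height (⟨p, h⟩ : ↥(Module.support R M))

/-- A Cohen–Macaulay module over a local ring: depth equals Krull dimension. -/
def IsCMModule [IsLocalRing R] (M : Type u) [AddCommGroup M] [Module R M] : Prop :=
  (mdepth R M : WithBot ℕ∞) = mdim R M

/-- A maximal Cohen–Macaulay module over a local ring. -/
def IsMaximalCM [IsLocalRing R] (M : Type u) [AddCommGroup M] [Module R M] : Prop :=
  IsCMModule R M ∧ mdim R M = ringKrullDim R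

/-- A Cohen–Macaulay local ring. -/
def IsCMLocalRing [IsLocalRing R] : Prop :=
  (mdepth R R : WithBot ℕ∞) = ringKrullDim R

/-- A Gorenstein local ring: a Noetherian local ring of finite self-injective dimension. -/
def IsGorensteinLocalRing [IsLocalRing R] : Prop :=
  IsNoetherianRing R ∧ ∃ n : ℕ, idLE R R n

/-- A regular local ring: Noetherian, and the maximal ideal is generated by `dim R` elements. -/
def IsRegularLocal [IsLocalRing R] : Prop :=
  IsNoetherianRing R ∧ ∃ s : Finset R, Ideal.span (s : Set R) = IsLocalRing.maximalIdeal R ∧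
    (s.card : WithBot ℕ∞) = ringKrullDim R

/-- A (not necessarily local) Gorenstein ring: all localizations at primes are Gorenstein. -/
def IsGorensteinRing : Prop :=
  ∀ p : PrimeSpectrum R, ∃ n : ℕ,
    idLE (Localization.AtPrime p.asIdeal) (Localization.AtPrime p.asIdeal) n

/-- `R` admits a dualizing complex; by Kawasaki's theorem this is equivalent to being a
homomorphic image of a finite-dimensional Gorenstein ring. -/
def HasDualizingComplex : Prop :=
  ∃ Q : CommRingCat.{u}, IsNoetherianRing Q ∧ ringKrullDim Q < ⊤ ∧ IsGorensteinRing Q ∧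
    ∃ f : Q →+* R, Function.Surjective f

section Cousin

/-- The product of the localizations of `N` at the primes in `S`. -/
noncomputable abbrev locProd (S : Set (PrimeSpectrum R)) (N : Type u) [AddCommGroup N]
    [Module R N] : Type u :=
  Π p : S, LocalizedModule p.1.asIdeal.primeCompl N

/-- The submodule of the product of localizations consisting of finitely supported families;
this is the direct sum `⊕_{p ∈ S} N_p`. -/
noncomputable def finSupp (S : Set (PrimeSpectrum R)) (N : Type u) [AddCommGroup N]
    [Module R N] : Submodule R (locProd R S N) where
  carrier := {f | {p : S | f p ≠ 0}.Finite}
  add_mem' := by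
    intro f g hf hg
    refine (hf.union hg).subset ?_
    intro p hp
    by_contra h
    simp only [Set.mem_union, Set.mem_setOf_eq, not_or, not_not] at h
    exact hp (by simp [Pi.add_apply, h.1, h.2])
  zero_mem' := by simp
  smul_mem' := by
    intro c f hf
    refine hf.subset ?_
    intro p hp
    by_contra h
    simp only [Set.mem_setOf_eq, not_not] at h
    exact hp (by simp [Pi.smul_apply, h])

/-- The canonical map `N → ∏_{p ∈ S} N_p`. -/
noncomputable def thetaFull (S : Set (PrimeSpectrum R)) (N : Type u) [AddCommGroup N]
    [Module R N] : N →ₗ[R] locProd R S N :=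
  LinearMap.pi fun p => LocalizedModule.mkLinearMap p.1.asIdeal.primeCompl N

/-- The cokernel of `N → ⊕_{p ∈ S} N_p` (computed inside the direct sum). -/
noncomputable abbrev nextKType (S : Set (PrimeSpectrum R)) (N : Type u) [AddCommGroup N]
    [Module R N] : Type u :=
  ↥(finSupp R S N) ⧸
    (Submodule.comap (finSupp R S N).subtype (LinearMap.range (thetaFull R S N)))

/-- The sequence of "kernel/cokernel" modules in the inductive construction
of the Cousin complex of `M` with respect to the filtration `F`. -/
noncomputable def cousinK (F : ℕ → Set (PrimeSpectrum R)) (M : ModuleCat.{u} R) :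
    ℕ → ModuleCat.{u} R
  | 0 => M
  | n + 1 => ModuleCat.of R (nextKType R (F n \ F (n + 1)) (cousinK F M n))

/-- The `n`-th term `M^n = ⊕_{p ∈ ∂F_n} (coker d^{n-2})_p` of the Cousin complex. -/
noncomputable abbrev cousinC (F : ℕ → Set (PrimeSpectrum R)) (M : ModuleCat.{u} R) (n : ℕ) :
    Type u :=
  ↥(finSupp R (F n \ F (n + 1)) (cousinK R F M n))

/-- The canonical map from the `n`-th cokernel into the product of its localizations. -/
noncomputable def cousinTheta (F : ℕ → Set (PrimeSpectrum R)) (M : ModuleCat.{u} R) (n : ℕ) :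
    (cousinK R F M n) →ₗ[R] locProd R (F n \ F (n + 1)) (cousinK R F M n) :=
  thetaFull R _ _

/-- The (full) `n`-th differential of the Cousin complex, from `M^n` to the product at
level `n+1` (it lands inside the direct sum `M^{n+1}`). -/
noncomputable def cousinD (F : ℕ → Set (PrimeSpectrum R)) (M : ModuleCat.{u} R) (n : ℕ) :
    (cousinC R F M n) →ₗ[R] locProd R (F (n + 1) \ F (n + 2)) (cousinK R F M (n + 1)) :=
  (cousinTheta R F M (n + 1)).comp
    (Submodule.mkQ (Submodule.comap (finSupp R (F n \ F (n + 1)) (cousinK R F M n)).subtype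
      (LinearMap.range (thetaFull R (F n \ F (n + 1)) (cousinK R F M n)))))

/-- `F` is a filtration of `Spec R`: descending, and every element of `∂F_n = F_n \ F_{n+1}`
is a minimal member of `F_n`. -/
def IsFiltration (F : ℕ → Set (PrimeSpectrum R)) : Prop :=
  (∀ n, F (n + 1) ⊆ F n) ∧
    ∀ n, ∀ p ∈ F n \ F (n + 1), ∀ q ∈ F n, q ≤ p → q = p

/-- The filtration `F` admits `M`. -/
def Admits (F : ℕ → Set (PrimeSpectrum R)) (M : Type u) [AddCommGroup M] [Module R M] : Prop :=
  Module.support R M ⊆ F 0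

/-- The `M`-height filtration `K_i = {p ∈ Supp M | ht_M p ≥ i}`. -/
noncomputable def heightFiltration (M : Type u) [AddCommGroup M] [Module R M] :
    ℕ → Set (PrimeSpectrum R) :=
  fun i => {p | p ∈ Module.support R M ∧ (i : ℕ∞) ≤ htM R M p}

/-- The Cousin complex `C(F, M)` is exact at `M, M⁰, …, M^t`
(together with the well-definedness of the differentials into the direct sums). -/
def CousinPartiallyExact (F : ℕ → Set (PrimeSpectrum R)) (M : ModuleCat.{u} R) (t : ℕ) : Prop :=
  (∀ n, LinearMap.range (cousinTheta R F M n) ≤ finSupp R (F n \ F (n + 1)) (cousinK R F M n)) ∧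
  Function.Injective (cousinTheta R F M 0) ∧
  (∀ n ≤ t, LinearMap.ker (cousinD R F M n) =
    Submodule.comap (finSupp R (F n \ F (n + 1)) (cousinK R F M n)).subtype
      (LinearMap.range (cousinTheta R F M n)))

/-- The Cousin complex `C(F, M)` is exact and all of its terms satisfy `P`, i.e. it provides
a `P`-resolution of `M`. -/
def CousinResolves (F : ℕ → Set (PrimeSpectrum R)) (M : ModuleCat.{u} R)
    (P : ModuleCat.{u} R → Prop) : Prop :=
  (∀ n, LinearMap.range (cousinTheta R F M n) ≤ finSupp R (F n \ F (n + 1)) (cousinK R F M n)) ∧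
  Function.Injective (cousinTheta R F M 0) ∧
  (∀ n, LinearMap.ker (cousinD R F M n) =
    Submodule.comap (finSupp R (F n \ F (n + 1)) (cousinK R F M n)).subtype
      (LinearMap.range (cousinTheta R F M n))) ∧
  (∀ n, P (ModuleCat.of R (cousinC R F M n)))

/-- A G–Gorenstein module: a nonzero finitely generated module whose Cousin complex with
respect to the `M`-height filtration is a Gorenstein injective resolution. -/
def IsGGorenstein (M : ModuleCat.{u} R) : Prop :=
  (∃ x : M, x ≠ 0) ∧ Module.Finite R M ∧
    CousinResolves R (heightFiltration R M) M (fun N => IsGorensteinInjective R N)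

/-- A Gorenstein module: a nonzero finitely generated module whose Cousin complex with
respect to the `M`-height filtration is an injective resolution. -/
def IsGorensteinModule (M : ModuleCat.{u} R) : Prop :=
  (∃ x : M, x ≠ 0) ∧ Module.Finite R M ∧
    CousinResolves R (heightFiltration R M) M (fun N => Module.Injective R N)

end Cousin

/-- A system of parameters of a local ring. -/
def IsSOP [IsLocalRing R] (rs : List R) : Prop :=
  (rs.length : WithBot ℕ∞) = ringKrullDim R ∧
    (∀ r ∈ rs, r ∈ IsLocalRing.maximalIdeal R) ∧
    IsLocalRing.maximalIdeal R ≤ (Ideal.span {r | r ∈ rs}).radical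

/-- A balanced big Cohen–Macaulay module: every system of parameters of `R` is a regular
sequence on `M`. -/
def IsBalancedBigCM [IsLocalRing R] (M : Type u) [AddCommGroup M] [Module R M] : Prop :=
  ∀ rs : List R, IsSOP R rs → RingTheory.Sequence.IsRegular M rs

end GG

namespace GGP
open CategoryTheory Opposite Limits

variable {R : Type u} [CommRing R]

/-- coordinates of cocycles -/
lemma root_ext_subsingleton (T M : ModuleCat.{u} R) (i : ℕ)
    (h : Subsingleton (Abelian.Ext T M i)) :
    Subsingleton (((_root_.Ext R (ModuleCat.{u} R) i).obj (op T)).obj M) := by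
  let P := projectiveResolution T
  rw [← ModuleCat.isZero_iff_subsingleton]
  refine IsZero.of_iso ?_ (P.isoExt (R := R) i M)
  rw [← HomologicalComplex.exactAt_iff_isZero_homology]
  cases i with
  | zero =>
    rw [HomologicalComplex.exactAt_iff' _ 0 0 1 (by simp) (by simp)]
    rw [ShortComplex.moduleCat_exact_iff]
    intro (f : P.complex.X 0 ⟶ M) hf
    have hf' : P.complex.d 1 0 ≫ f = 0 := hf
    obtain ⟨g, hg⟩ := CokernelCofork.IsColimit.desc' P.isColimitCokernelCofork f hf'
    have : g = 0 := by
      have := Subsingleton.elim (Abelian.Ext.mk₀ (show T ⟶ M from g)) 0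
      rwa [Abelian.Ext.mk₀_eq_zero_iff] at this
    refine ⟨(0 : P.complex.X 0 ⟶ M), ?_⟩
    rw [← hg, this]
    simp
    rfl
  | succ p =>
    rw [HomologicalComplex.exactAt_iff' _ p (p+1) (p+2) (by simp) (by simp)]
    rw [ShortComplex.moduleCat_exact_iff]
    intro (f : P.complex.X (p+1) ⟶ M) hf
    have hf' : P.complex.d (p+2) (p+1) ≫ f = 0 := hf
    obtain ⟨g, hg⟩ := (P.extMk_eq_zero_iff f (p+2) rfl hf' p rfl).1 (Subsingleton.elim _ _)
    exact ⟨g, hg⟩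

lemma smul_extMk {N M : ModuleCat.{u} R} (P : ProjectiveResolution N) {n m : ℕ}
    (f : P.complex.X n ⟶ M) (hm : n + 1 = m) (hf : P.complex.d m n ≫ f = 0) (r : R)
    (hf' : P.complex.d m n ≫ (r • f) = 0) :
    P.extMk (r • f) m hm hf' = r • P.extMk f m hm hf := by
  rw [Abelian.Ext.smul_eq_comp_mk₀, P.extMk_comp_mk₀]
  congr 1

lemma root_ext_inj (N M : ModuleCat.{u} R) (p : ℕ) :
    ∃ φ : (((_root_.Ext R (ModuleCat.{u} R) (p+1)).obj (op N)).obj M) →ₗ[R]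
      Abelian.Ext N M (p+1), Function.Injective φ := by
  let P := projectiveResolution N
  let K := P.complex.linearYonedaObj R M
  let e : (((_root_.Ext R (ModuleCat.{u} R) (p+1)).obj (op N)).obj M) ≅
      (K.sc' p (p+1) (p+2)).moduleCatLeftHomologyData.H :=
    (P.isoExt (R := R) (p+1) M) ≪≫
      ShortComplex.homologyMapIso (K.isoSc' p (p+1) (p+2) (by simp) (by simp)) ≪≫
      (K.sc' p (p+1) (p+2)).moduleCatHomologyIso
  let c : LinearMap.ker (K.sc' p (p+1) (p+2)).g.hom →ₗ[R] Abelian.Ext N M (p+1) :=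
    { toFun := fun f => P.extMk (show P.complex.X (p+1) ⟶ M from f.1) (p+2) rfl f.2
      map_add' := fun f g => (P.add_extMk _ _ _ _ _ _).symm
      map_smul' := fun r f => smul_extMk P _ _ _ r _ }
  have hc : LinearMap.ker c ≤ LinearMap.range (K.sc' p (p+1) (p+2)).moduleCatToCycles := by
    rintro ⟨f, hf⟩ h
    obtain ⟨g, hg⟩ := (P.extMk_eq_zero_iff (show P.complex.X (p+1) ⟶ M from f) (p+2) rfl hf p rfl).1 h
    exact ⟨g, Subtype.ext hg⟩
  have hc' : LinearMap.range (K.sc' p (p+1) (p+2)).moduleCatToCycles ≤ LinearMap.ker c := by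
    rintro _ ⟨g, rfl⟩
    exact (P.extMk_eq_zero_iff _ (p+2) rfl
      ((K.sc' p (p+1) (p+2)).moduleCatToCycles g).2 p rfl).2 ⟨g, rfl⟩
  let e' : (((_root_.Ext R (ModuleCat.{u} R) (p+1)).obj (op N)).obj M) ≃ₗ[R]
      (LinearMap.ker (K.sc' p (p+1) (p+2)).g.hom ⧸
        LinearMap.range (K.sc' p (p+1) (p+2)).moduleCatToCycles) := e.toLinearEquiv
  refine ⟨((LinearMap.range (K.sc' p (p+1) (p+2)).moduleCatToCycles).liftQ c hc').comp
    e'.toLinearMap, ?_⟩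
  rw [LinearMap.coe_comp]
  refine Function.Injective.comp ?_ e'.injective
  rw [← LinearMap.ker_eq_bot]
  exact Submodule.ker_liftQ_eq_bot _ _ _ hc
end GGP

namespace GGP
open CategoryTheory Opposite Limits GG

variable {R : Type u} [CommRing R]

section shift
variable {S : ShortComplex (ModuleCat.{u} R)}

lemma shift_cov1 (hS : S.ShortExact) (X : ModuleCat.{u} R) (n : ℕ) (h3 : Subsingleton (Abelian.Ext X S.X₃ n))
    (h2 : Subsingleton (Abelian.Ext X S.X₂ (n+1))) : Subsingleton (Abelian.Ext X S.X₁ (n+1)) := by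
  refine subsingleton_of_forall_eq 0 fun x => ?_
  obtain ⟨y, rfl⟩ := Abelian.Ext.covariant_sequence_exact₁ X hS x (Subsingleton.elim _ _) rfl
  rw [Subsingleton.elim y 0, Abelian.Ext.zero_comp]

lemma shift_cov3 (hS : S.ShortExact) (X : ModuleCat.{u} R) (n : ℕ) (h2 : Subsingleton (Abelian.Ext X S.X₂ n))
    (h1 : Subsingleton (Abelian.Ext X S.X₁ (n+1))) : Subsingleton (Abelian.Ext X S.X₃ n) := by
  refine subsingleton_of_forall_eq 0 fun x => ?_
  obtain ⟨y, rfl⟩ := Abelian.Ext.covariant_sequence_exact₃ X hS x rfl (Subsingleton.elim _ _)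
  rw [Subsingleton.elim y 0, Abelian.Ext.zero_comp]

lemma shift_contra1 (hS : S.ShortExact) (Y : ModuleCat.{u} R) (n : ℕ) (h2 : Subsingleton (Abelian.Ext S.X₂ Y n))
    (h3 : Subsingleton (Abelian.Ext S.X₃ Y (1+n))) : Subsingleton (Abelian.Ext S.X₁ Y n) := by
  refine subsingleton_of_forall_eq 0 fun x => ?_
  obtain ⟨y, rfl⟩ := Abelian.Ext.contravariant_sequence_exact₁ hS Y x rfl (Subsingleton.elim _ _)
  rw [Subsingleton.elim y 0, Abelian.Ext.comp_zero]

lemma shift_contra3 (hS : S.ShortExact) (Y : ModuleCat.{u} R) (n : ℕ) (h1 : Subsingleton (Abelian.Ext S.X₁ Y n))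
    (h2 : Subsingleton (Abelian.Ext S.X₂ Y (1+n))) : Subsingleton (Abelian.Ext S.X₃ Y (1+n)) := by
  refine subsingleton_of_forall_eq 0 fun x => ?_
  obtain ⟨y, rfl⟩ := Abelian.Ext.contravariant_sequence_exact₃ hS Y x (Subsingleton.elim _ _) rfl
  rw [Subsingleton.elim y 0, Abelian.Ext.comp_zero]

end shift

lemma iso_cov (X : ModuleCat.{u} R) {Y Y' : ModuleCat.{u} R} (e : Y ≅ Y') (n : ℕ)
    (h : Subsingleton (Abelian.Ext X Y' n)) : Subsingleton (Abelian.Ext X Y n) := by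
  refine subsingleton_of_forall_eq 0 fun x => ?_
  have : x = (x.comp (Abelian.Ext.mk₀ e.hom) (add_zero n)).comp (Abelian.Ext.mk₀ e.inv)
    (add_zero n) := by simp
  rw [this, Subsingleton.elim (x.comp _ _) 0, Abelian.Ext.zero_comp]

lemma iso_contra {X X' : ModuleCat.{u} R} (Y : ModuleCat.{u} R) (e : X ≅ X') (n : ℕ)
    (h : Subsingleton (Abelian.Ext X' Y n)) : Subsingleton (Abelian.Ext X Y n) := by
  refine subsingleton_of_forall_eq 0 fun x => ?_
  have : x = (Abelian.Ext.mk₀ e.hom).comp ((Abelian.Ext.mk₀ e.inv).comp x (zero_add n))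
    (zero_add n) := by simp
  rw [this, Subsingleton.elim (Abelian.Ext.comp _ x _) 0, Abelian.Ext.comp_zero]

/-- short exact sequence from linear maps -/
lemma shortExact_of {A B C : Type u} [AddCommGroup A] [Module R A] [AddCommGroup B] [Module R B]
    [AddCommGroup C] [Module R C] (f : A →ₗ[R] B) (g : B →ₗ[R] C) (hf : Function.Injective f)
    (hg : Function.Surjective g) (h : LinearMap.range f = LinearMap.ker g) :
    ∃ S : ShortComplex (ModuleCat.{u} R), S.ShortExact ∧ S.X₁ = ModuleCat.of R A ∧
      S.X₂ = ModuleCat.of R B ∧ S.X₃ = ModuleCat.of R C := by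
  have hz : ModuleCat.ofHom f ≫ ModuleCat.ofHom g = 0 := by
    ext x
    have : f x ∈ LinearMap.ker g := h ▸ LinearMap.mem_range_self f x
    simpa using this
  refine ⟨ShortComplex.mk (ModuleCat.ofHom f) (ModuleCat.ofHom g) hz, ?_, rfl, rfl, rfl⟩
  exact
    { exact := (ShortComplex.moduleCat_exact_iff_range_eq_ker _).2 h
      mono_f := (ModuleCat.mono_iff_injective _).2 hf
      epi_g := (ModuleCat.epi_iff_surjective _).2 hg }

lemma inj_obj (I : ModuleCat.{u} R) (h : Module.Injective R I) : Injective I :=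
  Module.injective_object_of_injective_module R I

lemma proj_obj (P : ModuleCat.{u} R) (h : Module.Projective R P) : Projective P :=
  (IsProjective.iff_projective P).1 h

/-- finite projective dimension kills high Ext -/
lemma ext_of_pd (n : ℕ) : ∀ (N : ModuleCat.{u} R), pdLE R N n → ∀ (Y : ModuleCat.{u} R) (k : ℕ),
    n < k → Subsingleton (Abelian.Ext N Y k) := by
  induction n with
  | zero =>
    rintro N ⟨G, d, ε, hP, hε, h0, h1, hz⟩ Y k hk
    have : Projective (G 0) := proj_obj _ (hP 0)
    have hi : LinearMap.ker ε = ⊥ := by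
      rw [h0, eq_bot_iff]
      rintro _ ⟨x, rfl⟩
      rw [hz 1 (by simp) x]; simp
    let e : G 0 ≃ₗ[R] N := LinearEquiv.ofBijective ε ⟨LinearMap.ker_eq_bot.1 hi, hε⟩
    obtain ⟨k, rfl⟩ : ∃ m, k = m + 1 := ⟨k - 1, by omega⟩
    exact iso_contra Y e.symm.toModuleIso _ (Abelian.Ext.subsingleton_of_projective _ _ _)
  | succ n ih =>
    rintro N ⟨G, d, ε, hP, hε, h0, h1, hz⟩ Y k hk
    obtain ⟨k, rfl⟩ : ∃ m, k = 1 + m := ⟨k - 1, by omega⟩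
    have : Projective (G 0) := proj_obj _ (hP 0)
    refine shift_contra3 (LinearMap.shortExact_shortComplexKer hε) Y k ?_ ?_
    · refine ih _ ⟨fun i => G (i+1), fun i => d (i+1), (d 0).codRestrict _ ?_, fun i => hP _,
        ?_, ?_, fun i => h1 _, fun i hi => hz _ (by omega)⟩ Y k (by omega)
      · intro x; rw [h0]; exact LinearMap.mem_range_self _ x
      · rintro ⟨x, hx⟩
        rw [h0] at hx
        obtain ⟨y, rfl⟩ := hx
        exact ⟨y, rfl⟩
      · rw [LinearMap.ker_codRestrict]; exact h1 0
    · rw [add_comm]; exact Abelian.Ext.subsingleton_of_projective _ _ _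

/-- finite injective dimension -/
lemma ext_of_id (Y : ModuleCat.{u} R) (hY : ∀ (I : ModuleCat.{u} R), Module.Injective R I →
    ∀ k, 0 < k → Subsingleton (Abelian.Ext I Y k)) (n : ℕ) :
    ∀ (N : ModuleCat.{u} R), idLE R N n → ∀ (k : ℕ), 0 < k → Subsingleton (Abelian.Ext N Y k) := by
  induction n with
  | zero =>
    rintro N ⟨G, d, ε, hP, hε, h0, h1, hz⟩ k hk
    have hi : LinearMap.range ε = ⊤ := by
      rw [h0, eq_top_iff]
      intro x _
      rw [LinearMap.mem_ker]; exact hz 1 (by simp) _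
    let e : N ≃ₗ[R] G 0 := LinearEquiv.ofBijective ε ⟨hε, LinearMap.range_eq_top.1 hi⟩
    exact iso_contra Y e.toModuleIso _ (hY _ (hP 0) k hk)
  | succ n ih =>
    rintro N ⟨G, d, ε, hP, hε, h0, h1, hz⟩ k hk
    obtain ⟨S, hS, e1, e2, e3⟩ := shortExact_of ε (d 0).rangeRestrict hε
      (LinearMap.surjective_rangeRestrict _) (by rw [LinearMap.ker_rangeRestrict, h0])
    have := shift_contra1 hS Y k
    rw [e1, e2, e3] at this
    refine this (hY _ (hP 0) k hk) ?_
    refine ih _ ⟨fun i => G (i+1), fun i => d (i+1), (LinearMap.range (d 0)).subtype, fun i => hP _,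
      Subtype.val_injective, ?_, fun i => h1 _, fun i hi => hz _ (by omega)⟩ _ (by omega)
    rw [Submodule.range_subtype]; exact h1 0

/-- Gorenstein injective modules are acyclic for modules of finite inj. or proj. dimension. -/
lemma ext_gorInj (G : ModuleCat.{u} R) (hG : IsGorensteinInjective R G) (N : ModuleCat.{u} R)
    (hN : (∃ n, idLE R N n) ∨ (∃ n, pdLE R N n)) (k : ℕ) (hk : 0 < k) :
    Subsingleton (Abelian.Ext N G k) := by
  obtain ⟨X, d, hX, hex, hhom, ⟨e⟩⟩ := hG
  have hXi : ∀ n, Injective (X n) := fun n => inj_obj _ (hX n)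
  let Z : ℤ → ModuleCat.{u} R := fun n => ModuleCat.of R (LinearMap.ker (d n))
  let δ : ∀ n, X n →ₗ[R] LinearMap.ker (d (n+1)) := fun n =>
    (d n).codRestrict _ (fun x => hex n ▸ LinearMap.mem_range_self _ x)
  have hδ : ∀ n, Function.Surjective (δ n) := by
    rintro n ⟨x, hx⟩
    rw [← hex n] at hx
    obtain ⟨y, rfl⟩ := hx
    exact ⟨y, rfl⟩
  have hker : ∀ n, LinearMap.range (LinearMap.ker (d n)).subtype = LinearMap.ker (δ n) := by
    intro n
    rw [Submodule.range_subtype, LinearMap.ker_codRestrict]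
  have key : ∀ n k, 0 < k → Subsingleton (Abelian.Ext N (Z n) k) := by
    rcases hN with ⟨m, hm⟩ | ⟨m, hm⟩
    · intro n k hk
      refine ext_of_id (Z n) ?_ m N hm k hk
      intro I hI k hk
      obtain ⟨k, rfl⟩ : ∃ m, k = m + 1 := ⟨k - 1, by omega⟩
      clear hk
      induction k generalizing n with
      | zero =>
        have hz : ModuleCat.ofHom (LinearMap.ker (d n)).subtype ≫ ModuleCat.ofHom (δ n) = 0 := by
          ext x
          have : (x : X n) ∈ LinearMap.ker (δ n) := hker n ▸ LinearMap.mem_range_self _ x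
          simpa using this
        let S := ShortComplex.mk _ _ hz
        have hS : S.ShortExact :=
          { exact := (ShortComplex.moduleCat_exact_iff_range_eq_ker _).2 (hker n)
            mono_f := (ModuleCat.mono_iff_injective _).2 Subtype.val_injective
            epi_g := (ModuleCat.epi_iff_surjective _).2 (hδ n) }
        refine subsingleton_of_forall_eq 0 fun x => ?_
        obtain ⟨y, rfl⟩ := Abelian.Ext.covariant_sequence_exact₁ I hS x
          (Abelian.Ext.eq_zero_of_injective _) (zero_add 1)
        obtain ⟨φ, rfl⟩ := (Abelian.Ext.mk₀_bijective _ _).2 y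
        obtain ⟨ψ, hψ⟩ := hhom I hI n ((LinearMap.ker (d (n+1))).subtype.comp φ.hom) (by
          ext z; exact (φ.hom z).2)
        have : φ = ModuleCat.ofHom ψ ≫ S.g := by
          ext z
          exact (LinearMap.congr_fun hψ z).symm
        rw [this, ← Abelian.Ext.mk₀_comp_mk₀]
        rw [Abelian.Ext.comp_assoc (h₂₃ := zero_add 1) (h := by simp), hS.comp_extClass]
        simp
      | succ k ih =>
        obtain ⟨S, hS, e1, e2, e3⟩ := shortExact_of (LinearMap.ker (d n)).subtype (δ n)
          Subtype.val_injective (hδ n) (hker n)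
        have := shift_cov1 hS I (k+1)
        rw [e1, e2, e3] at this
        exact this (ih (n+1)) (Abelian.Ext.subsingleton_of_injective I (X n) _)
    · have : ∀ t k n, 0 < k → m < k + t → Subsingleton (Abelian.Ext N (Z n) k) := by
        intro t
        induction t with
        | zero => intro k n hk hm'; exact ext_of_pd m N hm _ _ hm'
        | succ t ih =>
          intro k n hk hm'
          obtain ⟨S, hS, e1, e2, e3⟩ := shortExact_of (LinearMap.ker (d (n-1))).subtype (δ (n-1))
            Subtype.val_injective (hδ _) (hker _)
          have := shift_cov3 hS N k
          rw [e1, e2, e3] at this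
          obtain ⟨j, rfl⟩ : ∃ m, n = m + 1 := ⟨n - 1, by omega⟩
          rw [add_sub_cancel_right] at this
          obtain ⟨k, rfl⟩ : ∃ m, k = m + 1 := ⟨k - 1, by omega⟩
          exact this (Abelian.Ext.subsingleton_of_injective N (X j) _)
            (ih _ _ (by omega) (by omega))
      exact fun n k hk => this (m+1) k n hk (by omega)
  exact iso_cov N e.toModuleIso k (key 0 k hk)

/-- Ext out of a module killed by s to a module on which s is invertible. -/
lemma ext_inv (T X : ModuleCat.{u} R) (s : R) (hT : ∀ t : T, s • t = 0)
    (hX : Function.Bijective (fun x : X => s • x)) (k : ℕ) : Subsingleton (Abelian.Ext T X k) := by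
  refine subsingleton_of_forall_eq 0 fun x => ?_
  obtain ⟨e, h3⟩ : ∃ e : X ≅ X, e.hom = s • 𝟙 X :=
    ⟨(LinearEquiv.ofBijective (LinearMap.lsmul R X s) hX).toModuleIso, rfl⟩
  have h1 : (s • 𝟙 T) = 0 := by ext t; exact hT t
  have h2 : s • x = 0 := by
    have : s • x = (Abelian.Ext.mk₀ (s • 𝟙 T)).comp x (zero_add k) := by simp [Abelian.Ext.mk₀_smul]
    rw [this, h1]; simp
  rw [Abelian.Ext.smul_eq_comp_mk₀] at h2
  have : x = (x.comp (Abelian.Ext.mk₀ e.hom) (add_zero k)).comp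
    (Abelian.Ext.mk₀ e.inv) (add_zero k) := by simp
  rw [this, h3, h2, Abelian.Ext.zero_comp]

/-- Ext of a f.g. module into a direct sum -/
lemma ext_sum_eq [IsNoetherianRing R] {ι : Type u} (Y : ModuleCat.{u} R)
    (π : ι → (Y ⟶ Y))
    (hsum : ∀ y : Y, ∃ s : Finset ι, ∀ s', s ⊆ s' → ∑ i ∈ s', (π i).hom y = y) (k : ℕ) :
    ∀ (T : ModuleCat.{u} R) [Module.Finite R T] (x : Abelian.Ext T Y k),
    ∃ s : Finset ι, x = ∑ i ∈ s, x.comp (Abelian.Ext.mk₀ (π i)) (add_zero k) := by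
  classical
  induction k with
  | zero =>
    intro T _ x
    obtain ⟨φ, rfl⟩ := (Abelian.Ext.mk₀_bijective _ _).2 x
    obtain ⟨g, hg⟩ := (Module.Finite.fg_top : (⊤ : Submodule R T).FG)
    choose f hf using hsum
    let s := g.biUnion (fun t => f (φ.hom t))
    refine ⟨s, ?_⟩
    have : φ = ∑ i ∈ s, φ ≫ π i := by
      have h : φ.hom = ∑ i ∈ s, (π i).hom.comp φ.hom := by
        refine LinearMap.ext_on (s := (g : Set T)) hg fun t ht => ?_
        rw [LinearMap.sum_apply]
        exact (hf (φ.hom t) s (Finset.subset_biUnion_of_mem (fun t => f (φ.hom t)) ht)).symm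
      apply ModuleCat.hom_ext
      rw [ModuleCat.hom_sum]
      exact h
    conv_lhs => rw [this]
    simp only [Abelian.Ext.mk₀_comp_mk₀]
    exact map_sum Abelian.Ext.addEquiv₀.symm _ _
  | succ k ih =>
    intro T _ x
    obtain ⟨P, _, _, _, _, f, surjf⟩ := Module.exists_finite_presentation R T
    let exac := LinearMap.shortExact_shortComplexKer surjf
    obtain ⟨y, rfl⟩ := precomp_extClass_surjective_of_projective_X₂ Y exac k x
    obtain ⟨s, hs⟩ := ih (ModuleCat.of R (LinearMap.ker f)) y
    refine ⟨s, ?_⟩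
    conv_lhs => rw [hs]
    rw [map_sum]
    refine Finset.sum_congr rfl fun i _ => ?_
    change exac.extClass.comp (y.comp _ (add_zero k)) (add_comm 1 k) =
      (exac.extClass.comp y (add_comm 1 k)).comp _ (add_zero _)
    exact (Abelian.Ext.comp_assoc_of_third_deg_zero ..).symm

end GGP

namespace GGP
open CategoryTheory Opposite Limits GG

variable {R : Type u} [CommRing R]

/-- The support of `K` is contained in `A` (elementwise version). -/
def SuppIn (K : Type u) [AddCommGroup K] [Module R K] (A : Set (PrimeSpectrum R)) : Prop :=
  ∀ q, q ∉ A → ∀ k : K, ∃ s : R, s ∉ q.asIdeal ∧ s • k = 0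

lemma mk_kill {K : Type u} [AddCommGroup K] [Module R K] {A : Set (PrimeSpectrum R)}
    (hK : SuppIn K A) {p : PrimeSpectrum R} (hmin : ∀ q ∈ A, q ≤ p → q = p)
    {s : R} (hs : s ∈ p.asIdeal) (x : LocalizedModule p.asIdeal.primeCompl K) :
    ∃ m : ℕ, s ^ m • x = 0 := by
  induction x using LocalizedModule.induction_on with
  | h k t =>
  let W : Submonoid R := Submonoid.powers s ⊔ p.asIdeal.primeCompl
  have hsW : s ∈ W := Submonoid.mem_sup_left (Submonoid.mem_powers s)
  by_cases hd : Disjoint ((LinearMap.ker (LinearMap.toSpanSingleton R K k) : Ideal R) : Set R)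
      (W : Set R)
  · exfalso
    obtain ⟨q, hq, hle, hdis⟩ := Ideal.exists_le_prime_disjoint _ W hd
    have hqp : (⟨q, hq⟩ : PrimeSpectrum R) ≤ p := by
      intro a ha
      by_contra hap
      exact Set.disjoint_left.1 hdis ha
        (Submonoid.mem_sup_right (show a ∈ p.asIdeal.primeCompl from hap))
    have hqA : (⟨q, hq⟩ : PrimeSpectrum R) ∈ A := by
      by_contra hqA
      obtain ⟨a, ha, hak⟩ := hK _ hqA k
      exact ha (hle (by simpa using hak))
    have := hmin _ hqA hqp
    subst this
    exact Set.disjoint_left.1 hdis hs hsW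
  · rw [Set.not_disjoint_iff] at hd
    obtain ⟨a, ha, haW⟩ := hd
    obtain ⟨_, ⟨m, rfl⟩, u, hu, rfl⟩ := Submonoid.mem_sup.1 haW
    refine ⟨m, ?_⟩
    have h0 : (s ^ m * u) • k = 0 := by simpa using ha
    rw [LocalizedModule.smul'_mk, ← LocalizedModule.zero_mk 1, LocalizedModule.mk_eq]
    refine ⟨⟨u, hu⟩, ?_⟩
    change u • (1 : R) • s ^ m • k = u • t • (0 : K)
    rw [one_smul, smul_smul, mul_comm, h0]; simp

lemma fin_kill {K : Type u} [AddCommGroup K] [Module R K] {A B : Set (PrimeSpectrum R)}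
    (hK : SuppIn K A) (hmin : ∀ p ∈ A \ B, ∀ q ∈ A, q ≤ p → q = p)
    (hup : ∀ p ∈ A, ∀ q, p ≤ q → q ∈ A) {q : PrimeSpectrum R} (hq : q ∉ B)
    (y : finSupp R (A \ B) K) (hy : ∀ p : ↥(A \ B), p.1 = q → y.1 p = 0) :
    ∃ s : R, s ∉ q.asIdeal ∧ s • y = 0 := by
  classical
  have hone : ∀ p : ↥(A \ B), ∃ s : R, s ∉ q.asIdeal ∧ s • y.1 p = 0 := by
    intro p
    by_cases hpq : p.1 = q
    · exact ⟨1, fun h => q.2.ne_top ((Ideal.eq_top_iff_one _).2 h), by rw [hy p hpq, smul_zero]⟩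
    · have : ¬ p.1.asIdeal ≤ q.asIdeal := by
        intro hle
        have hqA := hup _ p.2.1 q hle
        exact hpq (hmin q ⟨hqA, hq⟩ _ p.2.1 hle)
      obtain ⟨s, hsp, hsq⟩ := Set.not_subset.1 this
      obtain ⟨m, hm⟩ := mk_kill hK (hmin _ p.2) hsp (y.1 p)
      exact ⟨s ^ m, fun h => hsq (q.2.mem_of_pow_mem _ h), hm⟩
  choose f hf1 hf2 using hone
  have hfin : {p : ↥(A \ B) | y.1 p ≠ 0}.Finite := y.2
  refine ⟨∏ p ∈ hfin.toFinset, f p, ?_, ?_⟩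
  · intro h
    obtain ⟨p, _, hp⟩ := (q.2.prod_mem_iff).1 h
    exact hf1 p hp
  · apply Subtype.ext
    funext p
    change (∏ p ∈ hfin.toFinset, f p) • y.1 p = 0
    by_cases hp : y.1 p = 0
    · rw [hp, smul_zero]
    · rw [← Finset.prod_erase_mul _ _ (hfin.mem_toFinset.2 hp), mul_smul, hf2, smul_zero]

lemma next_supp {K : Type u} [AddCommGroup K] [Module R K] {A B : Set (PrimeSpectrum R)}
    (hK : SuppIn K A) (hmin : ∀ p ∈ A \ B, ∀ q ∈ A, q ≤ p → q = p)
    (hup : ∀ p ∈ A, ∀ q, p ≤ q → q ∈ A)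
    (hr : LinearMap.range (thetaFull R (A \ B) K) ≤ finSupp R (A \ B) K) :
    SuppIn (nextKType R (A \ B) K) B := by
  intro q hq k
  obtain ⟨x, rfl⟩ := Submodule.mkQ_surjective _ k
  by_cases hqA : q ∈ A
  · obtain ⟨⟨k, t⟩, hkt⟩ : ∃ kt : K × q.asIdeal.primeCompl,
        x.1 ⟨q, hqA, hq⟩ = LocalizedModule.mk kt.1 kt.2 := by
      induction h : x.1 ⟨q, hqA, hq⟩ using LocalizedModule.induction_on with
      | h k t => exact ⟨⟨k, t⟩, rfl⟩
    let z : finSupp R (A \ B) K := ⟨thetaFull R (A \ B) K k, hr (LinearMap.mem_range_self _ k)⟩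
    obtain ⟨s, hs, hsy⟩ := fin_kill hK hmin hup hq ((t : R) • x - z) (by
      rintro ⟨p, hp⟩ rfl
      change (t : R) • x.1 ⟨p, hp⟩ - LocalizedModule.mkLinearMap _ K k = 0
      rw [hkt, LocalizedModule.mkLinearMap_apply, sub_eq_zero, LocalizedModule.smul'_mk,
        LocalizedModule.mk_eq]
      refine ⟨1, ?_⟩
      simp [Submonoid.smul_def])
    refine ⟨s * t, fun h => (q.2.mem_or_mem h).elim hs t.2, ?_⟩
    have h2 : (s * (t : R)) • x = s • z := by
      rw [smul_sub, sub_eq_zero] at hsy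
      rw [mul_smul, hsy]
    rw [← map_smul, h2, Submodule.mkQ_apply, Submodule.Quotient.mk_eq_zero]
    exact ⟨s • k, by rw [map_smul]; rfl⟩
  · obtain ⟨s, hs, hsx⟩ := fin_kill hK hmin hup hq x (by
      rintro ⟨p, hp⟩ rfl
      exact absurd hp.1 hqA)
    exact ⟨s, hs, by rw [← map_smul, hsx, map_zero]⟩

lemma htM_eq (M : Type u) [AddCommGroup M] [Module R M] {p : PrimeSpectrum R}
    (h : p ∈ Module.support R M) :
    htM R M p = Order.height (⟨p, h⟩ : ↥(Module.support R M)) := by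
  unfold htM
  exact iSup_pos h

lemma hf_up (M : Type u) [AddCommGroup M] [Module R M] (n : ℕ) :
    ∀ p ∈ heightFiltration R M n, ∀ q, p ≤ q → q ∈ heightFiltration R M n := by
  rintro p ⟨hp, hn⟩ q hpq
  have hq := Module.mem_support_mono hpq hp
  refine ⟨hq, hn.trans ?_⟩
  rw [htM_eq M hp, htM_eq M hq]
  exact Order.height_mono hpq

lemma hf_anti (M : Type u) [AddCommGroup M] [Module R M] {m n : ℕ} (h : m ≤ n) :
    heightFiltration R M n ⊆ heightFiltration R M m := by
  rintro p ⟨hp, hn⟩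
  exact ⟨hp, le_trans (by exact_mod_cast h) hn⟩

lemma hf_min (M : Type u) [AddCommGroup M] [Module R M] (n : ℕ) :
    ∀ p ∈ heightFiltration R M n \ heightFiltration R M (n + 1),
      ∀ q ∈ heightFiltration R M n, q ≤ p → q = p := by
  rintro p ⟨⟨hp, hn⟩, hp'⟩ q ⟨hq, hqn⟩ hqp
  by_contra hne
  apply hp'
  refine ⟨hp, ?_⟩
  rw [htM_eq M hp]
  rw [htM_eq M hq] at hqn
  have hlt : (⟨q, hq⟩ : ↥(Module.support R M)) < ⟨p, hp⟩ :=
    lt_of_le_of_ne hqp (fun h => hne (congrArg Subtype.val h))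
  push_cast
  exact (add_le_add_left hqn 1).trans (Order.height_add_one_le hlt)

section cousin
variable {M : ModuleCat.{u} R}

lemma cousin_supp (hM : IsGGorenstein R M) (n : ℕ) :
    SuppIn (cousinK R (heightFiltration R M) M n) (heightFiltration R M n) := by
  induction n with
  | zero =>
    intro q hq k
    have : q ∉ Module.support R M := fun h => hq ⟨h, by simp⟩
    rw [Module.notMem_support_iff'] at this
    exact this k
  | succ n ih => exact next_supp ih (hf_min _ n) (hf_up _ n) (hM.2.2.1 n)

lemma theta_inj (hM : IsGGorenstein R M) (n : ℕ) :
    Function.Injective (cousinTheta R (heightFiltration R M) M n) := by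
  cases n with
  | zero => exact hM.2.2.2.1
  | succ n =>
    have h := hM.2.2.2.2.1 n
    rw [injective_iff_map_eq_zero]
    intro k hk
    obtain ⟨x, rfl⟩ := Submodule.mkQ_surjective _ k
    have hx : x ∈ LinearMap.ker (cousinD R (heightFiltration R M) M n) := hk
    rw [h] at hx
    exact (Submodule.Quotient.mk_eq_zero _).2 hx

lemma cousin_ses (hM : IsGGorenstein R M) (n : ℕ) :
    ∃ S : ShortComplex (ModuleCat.{u} R), S.ShortExact ∧
      S.X₁ = cousinK R (heightFiltration R M) M n ∧
      S.X₂ = ModuleCat.of R (cousinC R (heightFiltration R M) M n) ∧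
      S.X₃ = cousinK R (heightFiltration R M) M (n + 1) := by
  refine shortExact_of ((cousinTheta R (heightFiltration R M) M n).codRestrict _
    (fun x => hM.2.2.1 n (LinearMap.mem_range_self _ x))) (Submodule.mkQ _) ?_
    (Submodule.mkQ_surjective _) ?_
  · intro x y h
    exact theta_inj hM n (congrArg Subtype.val h)
  · rw [Submodule.ker_mkQ]
    ext x
    constructor
    · rintro ⟨y, rfl⟩
      exact ⟨y, rfl⟩
    · rintro ⟨y, hy⟩
      exact ⟨y, Subtype.ext hy⟩

lemma ext_kill (hM : IsGGorenstein R M) (N : ModuleCat.{u} R) [Module.Finite R N]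
    (hN : (∃ n, idLE R N n) ∨ (∃ n, pdLE R N n)) (q : PrimeSpectrum R) (m : ℕ) :
    ∀ (n : ℕ) (x : Abelian.Ext N (cousinK R (heightFiltration R M) M n) m),
      q ∉ heightFiltration R M (n + m) → ∃ s : R, s ∉ q.asIdeal ∧ s • x = 0 := by
  classical
  induction m with
  | zero =>
    intro n x hq
    obtain ⟨φ, rfl⟩ := (Abelian.Ext.mk₀_bijective _ _).2 x
    obtain ⟨g, hg⟩ := (Module.Finite.fg_top : (⊤ : Submodule R N).FG)
    choose f hf1 hf2 using fun t : N => cousin_supp hM n q hq (φ.hom t)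
    refine ⟨∏ t ∈ g, f t, ?_, ?_⟩
    · intro h
      obtain ⟨p, _, hp⟩ := (q.2.prod_mem_iff).1 h
      exact hf1 p hp
    · have h0 : (∏ t ∈ g, f t) • φ.hom = 0 := by
        refine LinearMap.ext_on (s := (g : Set N)) hg fun t ht => ?_
        rw [LinearMap.smul_apply, ← Finset.prod_erase_mul _ _ ht, mul_smul, hf2, smul_zero]
        rfl
      have h1 : (∏ t ∈ g, f t) • φ = 0 := ModuleCat.hom_ext h0
      rw [← Abelian.Ext.mk₀_smul, h1, Abelian.Ext.mk₀_zero]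
  | succ m ih =>
    intro n x hq
    obtain ⟨S, hS, e1, e2, e3⟩ := cousin_ses hM n
    have hC := ext_gorInj _ (hM.2.2.2.2.2 n) N hN (m + 1) (by omega)
    have ih' := ih (n + 1)
    rw [← e2] at hC
    rw [← e3] at ih'
    revert x
    rw [← e1]
    intro x
    obtain ⟨y, rfl⟩ := Abelian.Ext.covariant_sequence_exact₁ N hS x (Subsingleton.elim _ _) rfl
    obtain ⟨s, hs, hsy⟩ := ih' y (by rwa [show n + 1 + m = n + (m + 1) by omega])
    exact ⟨s, hs, by rw [← Abelian.Ext.smul_comp, hsy, Abelian.Ext.zero_comp]⟩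

/-- Projection to one component. -/
noncomputable def compProj (S : Set (PrimeSpectrum R)) (K : Type u) [AddCommGroup K] [Module R K]
    (p : S) : finSupp R S K →ₗ[R] LocalizedModule p.1.asIdeal.primeCompl K :=
  (LinearMap.proj p).comp (finSupp R S K).subtype

open Classical in
/-- Inclusion of one component. -/
noncomputable def compIncl (S : Set (PrimeSpectrum R)) (K : Type u) [AddCommGroup K] [Module R K]
    (p : S) : LocalizedModule p.1.asIdeal.primeCompl K →ₗ[R] finSupp R S K :=
  (LinearMap.single R (fun p : S => LocalizedModule p.1.asIdeal.primeCompl K) p).codRestrict _ (by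
    intro c
    refine (Set.finite_singleton p).subset fun a ha => ?_
    by_contra h
    exact ha (by simp [Pi.single_eq_of_ne h]))

lemma ext_C (S : Set (PrimeSpectrum R)) (K : Type u) [AddCommGroup K] [Module R K]
    [IsNoetherianRing R] (T : ModuleCat.{u} R) [Module.Finite R T] (B : Set (PrimeSpectrum R))
    (hT : SuppIn T B) (hSB : ∀ p ∈ S, p ∉ B) (k : ℕ) :
    Subsingleton (Abelian.Ext T (ModuleCat.of R (finSupp R S K)) k) := by
  classical
  refine subsingleton_of_forall_eq 0 fun x => ?_
  obtain ⟨s, hs⟩ := ext_sum_eq (ModuleCat.of R (finSupp R S K))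
    (fun p : S => ModuleCat.ofHom (compProj S K p) ≫ ModuleCat.ofHom (compIncl S K p)) (by
      intro y
      have hfin : {p : S | y.1 p ≠ 0}.Finite := y.2
      refine ⟨hfin.toFinset, fun s' hs' => ?_⟩
      apply Subtype.ext
      funext p
      have : ∀ i : S, ((compIncl S K i (compProj S K i y)).1 : locProd R S K) p
          = if p = i then y.1 p else 0 := by
        intro i
        change (Pi.single i (y.1 i) : locProd R S K) p = _
        by_cases h : p = i
        · subst h; simp
        · simp [h]
      have h2 : ((∑ i ∈ s', compIncl S K i (compProj S K i y) : finSupp R S K).1 :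
          locProd R S K) p = y.1 p := by
        rw [Submodule.coe_sum, Finset.sum_apply]
        simp only [this]
        rw [Finset.sum_ite_eq]
        split_ifs with h
        · rfl
        · by_contra hne
          exact h (hs' (hfin.mem_toFinset.2 (fun h => hne h.symm)))
      exact h2) k T x
  rw [hs]
  refine Finset.sum_eq_zero fun p _ => ?_
  have : Subsingleton (Abelian.Ext T
      (ModuleCat.of R (LocalizedModule p.1.asIdeal.primeCompl K)) k) := by
    obtain ⟨g, hg⟩ := (Module.Finite.fg_top : (⊤ : Submodule R T).FG)
    choose f hf1 hf2 using fun t : T => hT p.1 (hSB _ p.2) t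
    have hs : (∏ t ∈ g, f t) ∉ p.1.asIdeal := by
      intro h
      obtain ⟨t, _, ht⟩ := (p.1.2.prod_mem_iff).1 h
      exact hf1 t ht
    refine ext_inv _ _ (∏ t ∈ g, f t) ?_ ?_ k
    · have h0 : LinearMap.lsmul R T (∏ t ∈ g, f t) = 0 := by
        refine LinearMap.ext_on (s := (g : Set T)) hg fun t ht => ?_
        rw [LinearMap.lsmul_apply, ← Finset.prod_erase_mul _ _ ht, mul_smul, hf2, smul_zero]
        rfl
      exact fun t => LinearMap.congr_fun h0 t
    · have := IsLocalizedModule.map_units (LocalizedModule.mkLinearMap p.1.asIdeal.primeCompl K)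
        (⟨∏ t ∈ g, f t, hs⟩ : p.1.asIdeal.primeCompl)
      exact (Module.End.isUnit_iff _).1 this
  rw [← Abelian.Ext.mk₀_comp_mk₀, ← Abelian.Ext.comp_assoc_of_second_deg_zero,
    Subsingleton.elim (x.comp _ _) 0, Abelian.Ext.zero_comp]

lemma ext_K [IsNoetherianRing R] (hM : IsGGorenstein R M) (T : ModuleCat.{u} R) [Module.Finite R T]
    (j : ℕ) (hT : SuppIn T (heightFiltration R M j)) (i : ℕ) : ∀ n, n + i < j →
    Subsingleton (Abelian.Ext T (cousinK R (heightFiltration R M) M n) i) := by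
  have hC : ∀ n k, n < j → Subsingleton (Abelian.Ext T
      (ModuleCat.of R (cousinC R (heightFiltration R M) M n)) k) := by
    intro n k hn
    exact ext_C _ _ T _ hT (fun p hp hj => hp.2 (hf_anti _ hn hj)) k
  induction i with
  | zero =>
    intro n hn
    obtain ⟨S, hS, e1, e2, e3⟩ := cousin_ses hM n
    have h := hC n 0 (by omega)
    rw [← e1]
    rw [← e2] at h
    have := hS.mono_f
    exact (Abelian.Ext.postcomp_mk₀_injective_of_mono T S.f).subsingleton
  | succ i ih =>
    intro n hn
    obtain ⟨S, hS, e1, e2, e3⟩ := cousin_ses hM n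
    have := shift_cov1 hS T i
    rw [e1, e2, e3] at this
    exact this (ih (n + 1) (by omega)) (hC n _ (by omega))

end cousin
end GGP

open GG CategoryTheory Opposite in
/-- Double-Ext vanishing against a G–Gorenstein module. -/
theorem stmt3 (R : Type u) [CommRing R] [IsNoetherianRing R] (hR : HasDualizingComplex R)
    (M : ModuleCat.{u} R) (hM : IsGGorenstein R M)
    (N : ModuleCat.{u} R) (hNf : Module.Finite R N)
    (hN : (∃ n, idLE R N n) ∨ (∃ n, pdLE R N n))
    (i j : ℕ) (hij : i < j) :
    Subsingleton
      (((_root_.Ext R (ModuleCat.{u} R) i).obj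
        (op (((_root_.Ext R (ModuleCat.{u} R) j).obj (op N)).obj M))).obj M) := by
  obtain ⟨j, rfl⟩ : ∃ p, j = p + 1 := ⟨j - 1, by omega⟩
  apply GGP.root_ext_subsingleton
  have := hM.2.1
  obtain ⟨φ, hφ⟩ := GGP.root_ext_inj N M j
  have hfin : Module.Finite R (((_root_.Ext R (ModuleCat.{u} R) (j + 1)).obj (op N)).obj M) :=
    Module.Finite.of_injective φ hφ
  refine GGP.ext_K hM _ (j + 1) ?_ i 0 (by omega)
  intro q hq k
  obtain ⟨s, hs, hsk⟩ := GGP.ext_kill hM N hN q (j + 1) 0 (φ k) (by rwa [zero_add])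
  refine ⟨s, hs, hφ ?_⟩
  rw [map_smul, map_zero]
  exact hsk
end

section
/- Let R be a commutative Noetherian ring with a dualizing complex, M a G–Gorenstein R-module, and x = (x₁,…,xₙ) a sequence that is simultaneously an M-regular sequence and an R-regular sequence. Then M/xM is a G–Gorenstein module over R/xR. -/
universe u

namespace GGProof
open GG

/-- `f` identifies the `R'`-module `K'` with the `x`-torsion of the `R`-module `K`. -/
structure TorsRel {R R' : Type u} [CommRing R] [CommRing R'] (π : R →+* R') (x : R)
    {K' K : Type u} [AddCommGroup K'] [Module R' K'] [AddCommGroup K] [Module R K]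
    (f : K' →+ K) : Prop where
  smul : ∀ r k, f (π r • k) = r • f k
  inj : Function.Injective f
  range : ∀ k, x • k = 0 → ∃ k', f k' = k

section
variable {R R' : Type u} [CommRing R] [CommRing R'] {π : R →+* R'} {x : R}

theorem TorsRel.tors {K' K : Type u} [AddCommGroup K'] [Module R' K'] [AddCommGroup K]
    [Module R K] {f : K' →+ K} (h : TorsRel π x f) (hx : π x = 0) (k : K') : x • f k = 0 := by
  rw [← h.smul, hx, zero_smul, map_zero]

theorem exists_tors (hπ : Function.Surjective π) (hker : ∀ r, π r = 0 ↔ ∃ s, r = x * s)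
    (K : Type u) [AddCommGroup K] [Module R K] :
    ∃ (K' : ModuleCat.{u} R') (f : K' →+ K), TorsRel π x f := by
  let T := Submodule.torsionBy R K x
  let _ : SMul R' T := ⟨fun s v => Function.surjInv hπ s • v⟩
  have hs : ∀ (c : R) (v : T), π c • v = c • v := by
    intro c v
    change Function.surjInv hπ (π c) • v = c • v
    have h0 : π (Function.surjInv hπ (π c) - c) = 0 := by
      rw [map_sub, Function.surjInv_eq hπ, sub_self]
    obtain ⟨s, hs⟩ := (hker _).1 h0
    rw [← sub_eq_zero, ← sub_smul, hs, mul_comm, mul_smul]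
    have : x • v = 0 := Subtype.ext (by simp)
    rw [this, smul_zero]
  let _ : Module R' T := hπ.moduleLeft π hs
  refine ⟨ModuleCat.of R' T, T.subtype.toAddMonoidHom, ?_, ?_, ?_⟩
  · intro r k
    exact congrArg Subtype.val (hs r k)
  · exact Subtype.val_injective
  · intro k hk
    exact ⟨⟨k, (Submodule.mem_torsionBy_iff x k).2 hk⟩, rfl⟩

/-- lifting a semilinear map through the torsion -/
theorem TorsRel.lift (hπ : Function.Surjective π) {A B' B : Type u}
    [AddCommGroup A] [Module R' A] [AddCommGroup B'] [Module R' B'] [AddCommGroup B] [Module R B]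
    {g : B' →+ B} (hg : TorsRel π x g) (d : A →+ B) (hd : ∀ r a, d (π r • a) = r • d a)
    (ht : ∀ a, x • d a = 0) :
    ∃ d' : A →ₗ[R'] B', ∀ a, g (d' a) = d a := by
  choose D hD using fun a => hg.range (d a) (ht a)
  refine ⟨{ toFun := D, map_add' := ?_, map_smul' := ?_ }, hD⟩
  · intro a b
    apply hg.inj
    rw [map_add, hD, hD, hD, map_add]
  · intro r a
    obtain ⟨r, rfl⟩ := hπ r
    apply hg.inj
    rw [hD, hd, RingHom.id_apply, hg.smul, hD]

theorem injective_tors (hπ : Function.Surjective π) (hx : π x = 0)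
    {K' K : Type u} [AddCommGroup K'] [Module R' K'] [AddCommGroup K] [Module R K]
    {f : K' →+ K} (h : TorsRel π x f) (hK : Module.Injective R K) : Module.Injective R' K' := by
  refine ⟨fun A B _ _ _ _ i hi g => ?_⟩
  let _ : Module R A := Module.compHom A π
  let _ : Module R B := Module.compHom B π
  let i' : A →ₗ[R] B :=
    { toFun := i, map_add' := i.map_add, map_smul' := fun r a => i.map_smul (π r) a }
  let g' : A →ₗ[R] K :=
    { toFun := fun a => f (g a), map_add' := fun a b => by simp,
      map_smul' := fun r a => by
        change f (g (π r • a)) = r • f (g a)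
        rw [g.map_smul, h.smul] }
  obtain ⟨l, hl⟩ := hK.out i' hi g'
  obtain ⟨l', hl'⟩ := h.lift hπ l.toAddMonoidHom (fun r a => l.map_smul r a) (fun a => by
    change x • l a = 0
    rw [← l.map_smul]
    change l (π x • a) = 0
    rw [hx, zero_smul, map_zero])
  exact ⟨l', fun a => h.inj ((hl' _).trans (hl a))⟩

theorem injective_div {E : Type u} [AddCommGroup E] [Module R E] (hE : Module.Injective R E)
    (hx : IsSMulRegular R x) (e : E) : ∃ e', x • e' = e := by
  obtain ⟨h, hh⟩ := hE.out (LinearMap.mulLeft R x) hx (LinearMap.toSpanSingleton R E e)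
  refine ⟨h 1, ?_⟩
  have := hh 1
  simp only [LinearMap.mulLeft_apply, mul_one, LinearMap.toSpanSingleton_apply, one_smul] at this
  rw [← this, ← map_smul, smul_eq_mul, mul_one]

theorem gorInj_div {N : Type u} [AddCommGroup N] [Module R N] (hN : IsGorensteinInjective R N)
    (hx : IsSMulRegular R x) (e : N) : ∃ e', x • e' = e := by
  obtain ⟨X, d, hX, hex, -, ⟨φ⟩⟩ := hN
  have key : ∀ n (v : X n), d n v = 0 → ∃ w, d n w = 0 ∧ x • w = v := by
    intro n v hv
    obtain ⟨m, rfl⟩ : ∃ m, n = m + 1 := ⟨n - 1, by ring⟩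
    have : v ∈ LinearMap.range (d m) := by rw [hex]; exact hv
    obtain ⟨u, rfl⟩ := this
    obtain ⟨u', rfl⟩ := injective_div (hX m) hx u
    refine ⟨d m u', ?_, by simp⟩
    have : d m u' ∈ LinearMap.ker (d (m + 1)) := by rw [← hex]; exact ⟨_, rfl⟩
    exact this
  obtain ⟨w, hw, hw'⟩ := key 0 (φ e) (φ e).2
  refine ⟨φ.symm ⟨w, hw⟩, ?_⟩
  apply φ.injective
  rw [map_smul, LinearEquiv.apply_symm_apply]
  exact Subtype.ext hw'

theorem exists_inj_emb (A : Type u) [AddCommGroup A] [Module R A] :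
    ∃ (E : ModuleCat.{u} R) (i : A →ₗ[R] E), Module.Injective R E ∧ Function.Injective i := by
  obtain ⟨pr⟩ := CategoryTheory.EnoughInjectives.presentation (ModuleCat.of R A)
  have h1 := pr.injective
  have h2 := pr.mono
  exact ⟨pr.J, pr.f.hom, Module.injective_module_of_injective_object R pr.J,
    (ModuleCat.mono_iff_injective pr.f).1 h2⟩

theorem hom_ext {X : ℤ → ModuleCat.{u} R} {d : ∀ n : ℤ, X n →ₗ[R] X (n + 1)}
    (hex : ∀ n, LinearMap.range (d n) = LinearMap.ker (d (n + 1)))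
    (hhom : ∀ (I : ModuleCat.{u} R), Module.Injective R I →
      ∀ (n : ℤ) (φ : I →ₗ[R] X (n + 1)), (d (n + 1)).comp φ = 0 →
        ∃ ψ : I →ₗ[R] X n, (d n).comp ψ = φ)
    (hx : x = 0 ∨ IsSMulRegular R x)
    (E : ModuleCat.{u} R) (hE : Module.Injective R E) (n : ℤ) (α : E →ₗ[R] X (n + 1))
    (hα : ∀ e, x • e = 0 → d (n + 1) (α e) = 0) :
    ∃ δ : E →ₗ[R] X n, ∀ e, x • e = 0 → d n (δ e) = α e := by
  have hdd : ∀ n v, d (n + 1) (d n v) = 0 := fun n v => by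
    have : d n v ∈ LinearMap.ker (d (n + 1)) := by rw [← hex]; exact ⟨_, rfl⟩
    exact this
  rcases hx with rfl | hx
  · obtain ⟨δ, hδ⟩ := hhom E hE n α (LinearMap.ext fun e => hα e (zero_smul _ _))
    exact ⟨δ, fun e _ => LinearMap.congr_fun hδ e⟩
  · have hdiv := injective_div hE hx
    choose D hD using hdiv
    have hβ0 : ∀ e e', x • e = x • e' → d (n + 1) (α e) = d (n + 1) (α e') := by
      intro e e' h
      rw [← sub_eq_zero, ← map_sub, ← map_sub]
      apply hα
      rw [smul_sub, h, sub_self]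
    let β : E →ₗ[R] X (n + 1 + 1) :=
      { toFun := fun e => d (n + 1) (α (D e))
        map_add' := fun a b => by
          rw [← map_add, ← map_add]
          apply hβ0
          rw [hD, smul_add, hD, hD]
        map_smul' := fun r a => by
          rw [RingHom.id_apply, ← map_smul, ← map_smul]
          apply hβ0
          rw [hD, smul_comm, hD] }
    have hβ : ∀ e, β (x • e) = d (n + 1) (α e) := fun e => hβ0 _ _ (hD _)
    obtain ⟨γ, hγ⟩ := hhom E hE (n + 1) β (LinearMap.ext fun e => hdd _ _)
    obtain ⟨δ, hδ⟩ := hhom E hE n (α - x • γ) (LinearMap.ext fun e => by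
      have h1 := hβ e
      have h2 := LinearMap.congr_fun hγ (x • e)
      simp only [LinearMap.comp_apply] at h2
      simp only [LinearMap.comp_apply, LinearMap.sub_apply, LinearMap.smul_apply, map_sub,
        LinearMap.zero_apply]
      rw [← map_smul γ, h2, h1, sub_self])
    refine ⟨δ, fun e he => ?_⟩
    have := LinearMap.congr_fun hδ e
    simp only [LinearMap.comp_apply, LinearMap.sub_apply, LinearMap.smul_apply] at this
    rw [this, ← map_smul, he, map_zero, sub_zero]

theorem gorInj_tors (hπ : Function.Surjective π) (hker : ∀ r, π r = 0 ↔ ∃ s, r = x * s)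
    (hx : x = 0 ∨ IsSMulRegular R x)
    {N' N : Type u} [AddCommGroup N'] [Module R' N'] [AddCommGroup N] [Module R N]
    {f : N' →+ N} (h : TorsRel π x f) (hN : IsGorensteinInjective R N) :
    IsGorensteinInjective R' N' := by
  have hx0 : π x = 0 := (hker x).2 ⟨1, by simp⟩
  obtain ⟨X, d, hX, hex, hhom, ⟨φ⟩⟩ := hN
  have hdd : ∀ n v, d (n + 1) (d n v) = 0 := fun n v => by
    have : d n v ∈ LinearMap.ker (d (n + 1)) := by rw [← hex]; exact ⟨_, rfl⟩
    exact this
  choose X' t ht using fun n => exists_tors hπ hker (X n)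
  choose d' hd' using fun n => (ht (n + 1)).lift hπ ((d n).toAddMonoidHom.comp (t n))
    (fun r a => by simp [(ht n).smul]) (fun a => by
      change x • d n (t n a) = 0
      rw [← map_smul, (ht n).tors hx0, map_zero])
  replace hd' : ∀ n a, t (n + 1) (d' n a) = d n (t n a) := hd'
  refine ⟨X', d', fun n => injective_tors hπ hx0 (ht n) (hX n), ?_, ?_, ?_⟩
  · intro n
    apply le_antisymm
    · rintro _ ⟨v, rfl⟩
      apply (ht _).inj
      rw [hd', hd', hdd, map_zero]
    · intro v hv
      have hv0 : d' (n + 1) v = 0 := hv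
      have h1 : d (n + 1) (t (n + 1) v) = 0 := by rw [← hd', hv0, map_zero]
      have h2 : t (n + 1) v ∈ LinearMap.range (d n) := by rw [hex]; exact h1
      obtain ⟨w, hw⟩ := h2
      have h3 : ∃ w1, x • w1 = 0 ∧ d n w1 = d n w := by
        rcases hx with rfl | hx
        · exact ⟨w, zero_smul _ _, rfl⟩
        · obtain ⟨m, rfl⟩ : ∃ m, n = m + 1 := ⟨n - 1, by ring⟩
          have h4 : x • w ∈ LinearMap.range (d m) := by
            rw [hex, LinearMap.mem_ker, map_smul, hw, (ht _).tors hx0]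
          obtain ⟨u, hu⟩ := h4
          obtain ⟨u', rfl⟩ := injective_div (hX m) hx u
          refine ⟨w - d m u', ?_, ?_⟩
          · rw [smul_sub, ← hu, map_smul, sub_self]
          · rw [map_sub, hdd, sub_zero]
      obtain ⟨w1, hw1, hw2⟩ := h3
      obtain ⟨w', rfl⟩ := (ht n).range w1 hw1
      refine ⟨w', (ht _).inj ?_⟩
      rw [hd', hw2, hw]
  · intro I' hI' n φ' hφ'
    let _ : Module R I' := Module.compHom I' π
    obtain ⟨E, i, hE, hi⟩ := exists_inj_emb (R := R) I'
    obtain ⟨E', fE, hfE⟩ := exists_tors hπ hker E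
    obtain ⟨i', hi'⟩ := hfE.lift hπ i.toAddMonoidHom (fun r a => i.map_smul r a) (fun a => by
      change x • i a = 0
      rw [← i.map_smul]
      change i (π x • a) = 0
      rw [hx0, zero_smul, map_zero])
    replace hi' : ∀ a, fE (i' a) = i a := hi'
    have hi'inj : Function.Injective i' := fun a b hab => hi (by rw [← hi', ← hi', hab])
    obtain ⟨ρ, hρ⟩ := hI'.out i' hi'inj LinearMap.id
    let _ : Module R E' := Module.compHom E' π
    let fE1 : E' →ₗ[R] E :=
      { toFun := fE, map_add' := map_add fE, map_smul' := fun r a => hfE.smul r a }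
    let α0 : E' →ₗ[R] X (n + 1) :=
      { toFun := fun e => t (n + 1) (φ' (ρ e)), map_add' := fun a b => by simp
        map_smul' := fun r a => by
          change t (n + 1) (φ' (ρ (π r • a))) = r • t (n + 1) (φ' (ρ a))
          rw [map_smul, map_smul, (ht _).smul] }
    obtain ⟨α, hα⟩ := (hX (n + 1)).out fE1 hfE.inj α0
    obtain ⟨δ, hδ⟩ := hom_ext hex hhom hx E hE n α (fun e he => by
      obtain ⟨e', rfl⟩ := hfE.range e he
      have h1 : α (fE e') = t (n + 1) (φ' (ρ e')) := hα e'
      have h2 : d' (n + 1) (φ' (ρ e')) = 0 := LinearMap.congr_fun hφ' (ρ e')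
      rw [h1, ← hd', h2, map_zero])
    obtain ⟨ψ, hψ⟩ := (ht n).lift hπ (A := I') (δ.toAddMonoidHom.comp i.toAddMonoidHom)
      (fun r a => by
        change δ (i (r • a)) = r • δ (i a)
        rw [map_smul, map_smul])
      (fun a => by
        change x • δ (i a) = 0
        rw [← map_smul, ← hi', hfE.tors hx0, map_zero])
    replace hψ : ∀ a, t n (ψ a) = δ (i a) := hψ
    refine ⟨ψ, LinearMap.ext fun a => (ht _).inj ?_⟩
    rw [LinearMap.comp_apply, hd', hψ, ← hi', hδ _ (hfE.tors hx0 _)]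
    have h1 : α (fE (i' a)) = t (n + 1) (φ' (ρ (i' a))) := hα _
    rw [h1, hρ]
    rfl
  · obtain ⟨l, hl⟩ := (ht 0).lift hπ
      ((LinearMap.ker (d 0)).subtype.toAddMonoidHom.comp (φ.toLinearMap.toAddMonoidHom.comp f))
      (fun r a => by simp [h.smul]) (fun a => by
        change x • (φ (f a)).1 = 0
        rw [← Submodule.coe_smul, ← map_smul, h.tors hx0, map_zero]; rfl)
    replace hl : ∀ a, t 0 (l a) = (φ (f a)).1 := hl
    have hlinj : Function.Injective l := fun a b hab => h.inj (φ.injective (Subtype.ext (by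
      rw [← hl, ← hl, hab])))
    have hrange : LinearMap.range l = LinearMap.ker (d' 0) := by
      apply le_antisymm
      · rintro _ ⟨v, rfl⟩
        apply (ht _).inj
        rw [hd', hl, map_zero]
        exact (φ (f v)).2
      · intro v hv
        have hv0 : d' 0 v = 0 := hv
        have h1 : d 0 (t 0 v) = 0 := by rw [← hd', hv0, map_zero]
        obtain ⟨w, hw⟩ := φ.surjective ⟨t 0 v, h1⟩
        obtain ⟨w', rfl⟩ := h.range w (φ.injective (by
          rw [map_smul, hw, map_zero]
          exact Subtype.ext ((ht 0).tors hx0 v)))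
        refine ⟨w', (ht 0).inj ?_⟩
        rw [hl, hw]
    exact ⟨(LinearEquiv.ofInjective l hlinj).trans (LinearEquiv.ofEq _ _ hrange)⟩

end

section
variable {R R' : Type u} [CommRing R] [CommRing R'] {π : R →+* R'} {x : R}

theorem map_lsmul (S : Submonoid R) (K : Type u) [AddCommGroup K] [Module R K] (x : R) :
    IsLocalizedModule.map S (LocalizedModule.mkLinearMap S K) (LocalizedModule.mkLinearMap S K)
      (LinearMap.lsmul R K x) = LinearMap.lsmul R _ x := by
  apply IsLocalizedModule.linearMap_ext S (LocalizedModule.mkLinearMap S K)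
    (LocalizedModule.mkLinearMap S K)
  refine LinearMap.ext fun k => ?_
  rw [LinearMap.comp_apply, LinearMap.comp_apply, IsLocalizedModule.map_apply,
    LinearMap.lsmul_apply, LinearMap.lsmul_apply, map_smul]

theorem loc_tors (hπ : Function.Surjective π) (hx0 : π x = 0)
    {K' K : Type u} [AddCommGroup K'] [Module R' K'] [AddCommGroup K] [Module R K]
    {f : K' →+ K} (h : TorsRel π x f) (p : PrimeSpectrum R) (p' : PrimeSpectrum R')
    (hp : PrimeSpectrum.comap π p' = p) :
    ∃ F : LocalizedModule p'.asIdeal.primeCompl K' →+ LocalizedModule p.asIdeal.primeCompl K,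
      TorsRel π x F ∧ ∀ k, F (LocalizedModule.mkLinearMap p'.asIdeal.primeCompl K' k) =
        LocalizedModule.mkLinearMap p.asIdeal.primeCompl K (f k) := by
  subst hp
  set S := (PrimeSpectrum.comap π p').asIdeal.primeCompl with hS
  have hmem : ∀ r, r ∈ S ↔ π r ∈ p'.asIdeal.primeCompl := fun r => Iff.rfl
  let _ : Module R K' := Module.compHom K' π
  let _ : Module R (LocalizedModule p'.asIdeal.primeCompl K') := Module.compHom _ π
  let g : K' →ₗ[R] LocalizedModule p'.asIdeal.primeCompl K' :=
    { toFun := LocalizedModule.mkLinearMap p'.asIdeal.primeCompl K'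
      map_add' := map_add _
      map_smul' := fun r a => map_smul (LocalizedModule.mkLinearMap p'.asIdeal.primeCompl K') (π r) a }
  have hloc' : IsLocalizedModule p'.asIdeal.primeCompl
    (LocalizedModule.mkLinearMap p'.asIdeal.primeCompl K') := inferInstance
  have hloc : IsLocalizedModule S g := by
    refine ⟨?_, ?_, ?_⟩
    · intro s
      rw [Module.End.isUnit_iff]
      have := (Module.End.isUnit_iff _).1 (hloc'.map_units ⟨π s.1, (hmem _).1 s.2⟩)
      exact this
    · intro y
      obtain ⟨⟨k, s⟩, hks⟩ := hloc'.surj y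
      obtain ⟨r, hr⟩ := hπ s.1
      refine ⟨⟨k, ⟨r, (hmem r).2 (hr ▸ s.2)⟩⟩, ?_⟩
      exact (congrArg (fun z => z • y) hr).trans hks
    · intro a b hab
      obtain ⟨s, hs⟩ := hloc'.exists_of_eq hab
      obtain ⟨r, hr⟩ := hπ s.1
      refine ⟨⟨r, (hmem r).2 (hr ▸ s.2)⟩, ?_⟩
      change π r • a = π r • b
      rw [hr]
      exact hs
  let f1 : K' →ₗ[R] K :=
    { toFun := f, map_add' := map_add f, map_smul' := fun r a => h.smul r a }
  let m : K →ₗ[R] K := LinearMap.lsmul R K x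
  have hexact : Function.Exact f1 m := by
    intro k
    constructor
    · exact fun hk => h.range k hk
    · rintro ⟨k', rfl⟩
      exact h.tors hx0 k'
  let mk := LocalizedModule.mkLinearMap S K
  let F := IsLocalizedModule.map S g mk f1
  have hF := IsLocalizedModule.map_exact S g mk mk f1 m hexact
  have hm : IsLocalizedModule.map S mk mk m = LinearMap.lsmul R _ x := by
    exact map_lsmul _ _ _
  refine ⟨F.toAddMonoidHom, ⟨fun r k => F.map_smul r k, ?_, ?_⟩, fun k => ?_⟩
  · exact IsLocalizedModule.map_injective S g mk f1 h.inj
  · intro k hk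
    refine (hF k).1 ?_
    rw [hm]
    exact hk
  · exact IsLocalizedModule.map_apply S g mk f1 k

theorem loc_zero (p : PrimeSpectrum R) (hxp : x ∉ p.asIdeal) {K : Type u} [AddCommGroup K]
    [Module R K] (k : LocalizedModule p.asIdeal.primeCompl K) (hk : x • k = 0) : k = 0 := by
  have := (Module.End.isUnit_iff _).1 (IsLocalizedModule.map_units
    (LocalizedModule.mkLinearMap p.asIdeal.primeCompl K) (⟨x, hxp⟩ : p.asIdeal.primeCompl))
  apply this.1
  simpa using hk

theorem locProd_smul {S : Set (PrimeSpectrum R)} {N : Type u} [AddCommGroup N] [Module R N]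
    (r : R) (c : locProd R S N) (p : S) : (r • c) p = r • c p := rfl

theorem prod_tors (hπ : Function.Surjective π) (hker : ∀ r, π r = 0 ↔ ∃ s, r = x * s)
    {K' K : Type u} [AddCommGroup K'] [Module R' K'] [AddCommGroup K] [Module R K]
    {f : K' →+ K} (h : TorsRel π x f)
    (S : Set (PrimeSpectrum R)) (S' : Set (PrimeSpectrum R'))
    (hS : ∀ p', p' ∈ S' ↔ PrimeSpectrum.comap π p' ∈ S) :
    ∃ Φ : locProd R' S' K' →+ locProd R S K, TorsRel π x Φ ∧
      (∀ k, Φ (thetaFull R' S' K' k) = thetaFull R S K (f k)) ∧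
      (∀ c, Φ c ∈ finSupp R S K ↔ c ∈ finSupp R' S' K') := by
  classical
  have hx0 : π x = 0 := (hker x).2 ⟨1, by simp⟩
  have hcinj : Function.Injective (PrimeSpectrum.comap π) :=
    PrimeSpectrum.comap_injective_of_surjective π hπ
  choose F hF hFmk using fun (p : S) (p' : S') (hp : PrimeSpectrum.comap π p'.1 = p.1) =>
    loc_tors hπ hx0 h p.1 p'.1 hp
  let ex : S → Prop := fun p => ∃ p' : S', PrimeSpectrum.comap π p'.1 = p.1
  have hex : ∀ p : S, x ∈ p.1.asIdeal → ex p := by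
    intro p hxp
    have : p.1 ∈ Set.range (PrimeSpectrum.comap π) := by
      rw [range_comap_of_surjective _ _ hπ]
      intro r hr
      obtain ⟨s, rfl⟩ := (hker r).1 hr
      exact Ideal.mul_mem_right _ _ hxp
    obtain ⟨p', hp'⟩ := this
    exact ⟨⟨p', (hS p').2 (hp' ▸ p.2)⟩, hp'⟩
  have hzero : ∀ p : S, ¬ ex p → ∀ k : LocalizedModule p.1.asIdeal.primeCompl K,
      x • k = 0 → k = 0 := fun p hp k hk =>
    loc_zero p.1 (fun hxp => hp (hex p hxp)) k hk
  let Φ0 : locProd R' S' K' → locProd R S K := fun c p =>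
    if hp : ex p then F p hp.choose hp.choose_spec (c hp.choose) else 0
  have hΦ1 : ∀ c (p : S) (p' : S') (hp : PrimeSpectrum.comap π p'.1 = p.1),
      Φ0 c p = F p p' hp (c p') := by
    intro c p p' hp
    have he : ex p := ⟨p', hp⟩
    have h1 : Φ0 c p = F p he.choose he.choose_spec (c he.choose) := dif_pos he
    rw [h1]
    have h2 : he.choose = p' := Subtype.ext (hcinj (he.choose_spec.trans hp.symm))
    have : ∀ (q : S') (hq : PrimeSpectrum.comap π q.1 = p.1), q = p' →
        F p q hq (c q) = F p p' hp (c p') := by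
      rintro q hq rfl
      rfl
    exact this _ _ h2
  have hΦ2 : ∀ c (p : S), ¬ ex p → Φ0 c p = 0 := fun c p hp => dif_neg hp
  let Φ : locProd R' S' K' →+ locProd R S K := AddMonoidHom.mk' Φ0 (by
    intro a b
    funext p
    by_cases hp : ex p
    · obtain ⟨p', hp'⟩ := hp
      rw [Pi.add_apply, hΦ1 _ p p' hp', hΦ1 _ p p' hp', hΦ1 _ p p' hp', Pi.add_apply, map_add]
    · rw [Pi.add_apply, hΦ2 _ p hp, hΦ2 _ p hp, hΦ2 _ p hp, add_zero])
  let up : S' → S := fun p' => ⟨PrimeSpectrum.comap π p'.1, (hS _).1 p'.2⟩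
  have hup : Function.Injective up := fun a b hab =>
    Subtype.ext (hcinj (congrArg Subtype.val hab))
  have hΦup : ∀ c p', Φ c (up p') = F (up p') p' rfl (c p') := fun c p' => hΦ1 c _ _ _
  refine ⟨Φ, ⟨?_, ?_, ?_⟩, ?_, ?_⟩
  · intro r c
    funext p
    by_cases hp : ex p
    · obtain ⟨p', hp'⟩ := hp
      rw [locProd_smul]
      refine (hΦ1 _ p p' hp').trans ?_
      rw [locProd_smul, (hF _ _ _).smul]
      exact congrArg _ (hΦ1 _ p p' hp').symm
    · rw [locProd_smul]
      refine (hΦ2 _ p hp).trans ?_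
      rw [show Φ c p = 0 from hΦ2 _ p hp, smul_zero]
  · intro a b hab
    funext p'
    apply (hF (up p') p' rfl).inj
    rw [← hΦup, ← hΦup, hab]
  · intro c hc
    have hcp : ∀ p, x • c p = 0 := fun p => congrFun hc p
    choose c' hc' using fun p' : S' => (hF (up p') p' rfl).range (c (up p')) (hcp _)
    refine ⟨c', ?_⟩
    funext p
    by_cases hp : ex p
    · obtain ⟨p', hp'⟩ := hp
      obtain rfl : up p' = p := Subtype.ext hp'
      rw [hΦup, hc']
    · exact (hΦ2 _ p hp).trans (hzero p hp _ (hcp p)).symm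
  · intro k
    funext p
    by_cases hp : ex p
    · obtain ⟨p', hp'⟩ := hp
      exact (hΦ1 _ p p' hp').trans (hFmk p p' hp' k)
    · refine (hΦ2 _ p hp).trans (hzero p hp _ ?_).symm
      rw [← locProd_smul, ← map_smul, h.tors hx0, map_zero]
      rfl
  · intro c
    have hne : ∀ p', c p' ≠ 0 ↔ Φ c (up p') ≠ 0 := fun p' => by
      rw [hΦup, ne_eq, ne_eq, map_eq_zero_iff _ (hF _ _ _).inj]
    change {p : S | Φ c p ≠ 0}.Finite ↔ {p' : S' | c p' ≠ 0}.Finite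
    constructor
    · intro hfin
      refine (hfin.preimage (f := up) hup.injOn).subset ?_
      intro p' hp'
      exact (hne p').1 hp'
    · intro hfin
      refine (hfin.image up).subset ?_
      intro p hp
      by_cases he : ex p
      · obtain ⟨p', hp'⟩ := he
        obtain rfl : up p' = p := Subtype.ext hp'
        exact ⟨p', (hne p').2 hp, rfl⟩
      · exact absurd (hΦ2 _ p he) hp

theorem nextK_tors (hπ : Function.Surjective π) (hker : ∀ r, π r = 0 ↔ ∃ s, r = x * s)
    {K' K : Type u} [AddCommGroup K'] [Module R' K'] [AddCommGroup K] [Module R K]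
    {f : K' →+ K} (h : TorsRel π x f)
    (S : Set (PrimeSpectrum R)) (S' : Set (PrimeSpectrum R'))
    (hS : ∀ p', p' ∈ S' ↔ PrimeSpectrum.comap π p' ∈ S)
    (hfin : LinearMap.range (thetaFull R S K) ≤ finSupp R S K)
    (hinj : Function.Injective (thetaFull R S K))
    (hx : x = 0 ∨ ∀ k : K, ∃ k', x • k' = k) :
    LinearMap.range (thetaFull R' S' K') ≤ finSupp R' S' K' ∧
    Function.Injective (thetaFull R' S' K') ∧
    (∃ Φ : finSupp R' S' K' →+ finSupp R S K, TorsRel π x Φ) ∧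
    (∃ f1 : nextKType R' S' K' →+ nextKType R S K, TorsRel π x f1) := by
  have hx0 : π x = 0 := (hker x).2 ⟨1, by simp⟩
  obtain ⟨Φ, hΦ, hΦθ, hΦfin⟩ := prod_tors hπ hker h S S' hS
  let Ψ : finSupp R' S' K' →+ finSupp R S K :=
    (Φ.comp (finSupp R' S' K').subtype.toAddMonoidHom).codRestrict (finSupp R S K)
      (fun c => (hΦfin c.1).2 c.2)
  have hΨv : ∀ c, (Ψ c).1 = Φ c.1 := fun c => rfl
  have hΨ : TorsRel π x Ψ := by
    refine ⟨fun r k => Subtype.ext (hΦ.smul r k.1), ?_, ?_⟩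
    · intro a b hab
      exact Subtype.ext (hΦ.inj (congrArg Subtype.val hab))
    · intro c hc
      obtain ⟨c', hc'⟩ := hΦ.range c.1 (congrArg Subtype.val hc)
      exact ⟨⟨c', (hΦfin c').1 (hc' ▸ c.2)⟩, Subtype.ext hc'⟩
  refine ⟨?_, ?_, ⟨Ψ, hΨ⟩, ?_⟩
  · rintro _ ⟨k, rfl⟩
    rw [← hΦfin, hΦθ]
    exact hfin ⟨_, rfl⟩
  · intro a b hab
    apply h.inj
    apply hinj
    rw [← hΦθ, ← hΦθ, hab]
  · let P' := Submodule.comap (finSupp R' S' K').subtype (LinearMap.range (thetaFull R' S' K'))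
    let P := Submodule.comap (finSupp R S K).subtype (LinearMap.range (thetaFull R S K))
    let f1 : nextKType R' S' K' →+ nextKType R S K :=
      QuotientAddGroup.lift P'.toAddSubgroup (P.mkQ.toAddMonoidHom.comp Ψ) (by
        rintro c ⟨k, hk⟩
        refine (Submodule.Quotient.mk_eq_zero P).2 ⟨f k, ?_⟩
        rw [← hΦθ, hk]
        rfl)
    have hf1 : ∀ c, f1 (P'.mkQ c) = P.mkQ (Ψ c) := fun c => rfl
    refine ⟨f1, ?_, ?_, ?_⟩
    · intro r k
      obtain ⟨c, rfl⟩ := P'.mkQ_surjective k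
      rw [hf1, ← map_smul, hf1, hΨ.smul, map_smul]
    · rw [injective_iff_map_eq_zero]
      intro k hk
      obtain ⟨c, rfl⟩ := P'.mkQ_surjective k
      rw [hf1] at hk
      obtain ⟨k, hk⟩ := (Submodule.Quotient.mk_eq_zero P).1 hk
      replace hk : thetaFull R S K k = Φ c.1 := hk
      obtain ⟨k', rfl⟩ := h.range k (hinj (by
        rw [map_smul, hk, hΦ.tors hx0, map_zero]))
      refine (Submodule.Quotient.mk_eq_zero P').2 ⟨k', ?_⟩
      apply hΦ.inj
      rw [hΦθ, hk]
      rfl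
    · intro q hq
      obtain ⟨c, rfl⟩ := P.mkQ_surjective q
      rw [← map_smul] at hq
      obtain ⟨k, hk⟩ := (Submodule.Quotient.mk_eq_zero P).1 hq
      replace hk : thetaFull R S K k = x • c.1 := hk
      have : ∃ k1, x • (c.1 - thetaFull R S K k1) = 0 := by
        rcases hx with rfl | hx
        · exact ⟨0, zero_smul _ _⟩
        · obtain ⟨k1, rfl⟩ := hx k
          exact ⟨k1, by rw [smul_sub, ← hk, map_smul, sub_self]⟩
      obtain ⟨k1, hk1⟩ := this
      obtain ⟨c', hc'⟩ := hΨ.range (c - ⟨thetaFull R S K k1, hfin ⟨_, rfl⟩⟩) (Subtype.ext hk1)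
      refine ⟨P'.mkQ c', ?_⟩
      rw [hf1, hc', map_sub, sub_eq_self]
      exact (Submodule.Quotient.mk_eq_zero P).2 ⟨k1, rfl⟩

theorem base_tors
    {M' M : Type u} [AddCommGroup M'] [Module R' M'] [AddCommGroup M] [Module R M]
    (g : M →+ M') (hg : ∀ r m, g (r • m) = π r • g m) (hgs : Function.Surjective g)
    (hgk : ∀ m, g m = 0 ↔ ∃ m1, m = x • m1) (hxM : IsSMulRegular M x)
    (S : Set (PrimeSpectrum R))
    (hfin : LinearMap.range (thetaFull R S M) ≤ finSupp R S M)
    (hinj : Function.Injective (thetaFull R S M))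
    (hdiv : ∀ c : finSupp R S M, ∃ c', x • c' = c) :
    ∃ f1 : M' →+ nextKType R S M, TorsRel π x f1 := by
  let P := Submodule.comap (finSupp R S M).subtype (LinearMap.range (thetaFull R S M))
  let θ : M →ₗ[R] finSupp R S M := (thetaFull R S M).codRestrict _ (fun m => hfin ⟨m, rfl⟩)
  have hP : ∀ c, P.mkQ c = 0 ↔ ∃ m, θ m = c := by
    intro c
    refine (Submodule.Quotient.mk_eq_zero P).trans ⟨?_, ?_⟩
    · rintro ⟨m, hm⟩
      exact ⟨m, Subtype.ext hm⟩
    · rintro ⟨m, rfl⟩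
      exact ⟨m, rfl⟩
  have hθinj : Function.Injective θ := fun a b hab => hinj (congrArg Subtype.val hab)
  have htf : ∀ c c' : finSupp R S M, x • c = x • c' → c = c' := by
    intro c c' hc
    apply Subtype.ext
    funext p
    have h1 : x • c.1 p = x • c'.1 p := congrFun (congrArg Subtype.val hc) p
    have h2 : IsSMulRegular (LocalizedModule p.1.asIdeal.primeCompl M) x := by
      have := IsLocalizedModule.map_injective p.1.asIdeal.primeCompl
        (LocalizedModule.mkLinearMap p.1.asIdeal.primeCompl M)
        (LocalizedModule.mkLinearMap p.1.asIdeal.primeCompl M) (LinearMap.lsmul R M x) hxM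
      have hm : IsLocalizedModule.map p.1.asIdeal.primeCompl
        (LocalizedModule.mkLinearMap p.1.asIdeal.primeCompl M)
        (LocalizedModule.mkLinearMap p.1.asIdeal.primeCompl M) (LinearMap.lsmul R M x) =
          LinearMap.lsmul R _ x := by
        exact map_lsmul _ _ _
      rw [hm] at this
      exact this
    exact h2 h1
  choose D hD using hdiv
  let f0 : M' → nextKType R S M := fun m' => P.mkQ (D (θ (Function.surjInv hgs m')))
  have hf0 : ∀ m c, x • c = θ m → f0 (g m) = P.mkQ c := by
    intro m c hc
    have h1 : g (m - Function.surjInv hgs (g m)) = 0 := by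
      rw [map_sub, Function.surjInv_eq hgs, sub_self]
    obtain ⟨m2, hm2⟩ := (hgk _).1 h1
    change P.mkQ (D (θ (Function.surjInv hgs (g m)))) = P.mkQ c
    rw [eq_comm, ← sub_eq_zero, ← map_sub, hP]
    refine ⟨m2, htf _ _ ?_⟩
    rw [← map_smul, ← hm2, smul_sub, hc, hD, map_sub]
  let f1 : M' →+ nextKType R S M := AddMonoidHom.mk' f0 (by
    intro a b
    obtain ⟨a, rfl⟩ := hgs a
    obtain ⟨b, rfl⟩ := hgs b
    rw [← map_add, hf0 a _ (hD _), hf0 b _ (hD _),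
      hf0 (a + b) (D (θ a) + D (θ b)) (by rw [smul_add, hD, hD, map_add]), map_add])
  have hf1 : ∀ m c, x • c = θ m → f1 (g m) = P.mkQ c := hf0
  refine ⟨f1, ?_, ?_, ?_⟩
  · intro r k
    obtain ⟨m, rfl⟩ := hgs k
    rw [← hg, hf1 m _ (hD _), hf1 (r • m) (r • D (θ m)) (by rw [smul_comm, hD, map_smul]), map_smul]
  · rw [injective_iff_map_eq_zero]
    intro k hk
    obtain ⟨m, rfl⟩ := hgs k
    rw [hf1 m _ (hD _), hP] at hk
    obtain ⟨m1, hm1⟩ := hk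
    refine (hgk m).2 ⟨m1, hθinj ?_⟩
    rw [map_smul, hm1, hD]
  · intro q hq
    obtain ⟨c, rfl⟩ := P.mkQ_surjective q
    rw [← map_smul, hP] at hq
    obtain ⟨m, hm⟩ := hq
    exact ⟨g m, hf1 m c hm.symm⟩

end

section
variable {R R' : Type u} [CommRing R] [CommRing R'] {π : R →+* R'} {x : R}

theorem theta_inj {F : ℕ → Set (PrimeSpectrum R)} {M : ModuleCat.{u} R}
    {P : ModuleCat.{u} R → Prop} (h : CousinResolves R F M P) (n : ℕ) :
    Function.Injective (thetaFull R (F n \ F (n + 1)) (cousinK R F M n)) := by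
  obtain ⟨-, h0, hex, -⟩ := h
  cases n with
  | zero => exact h0
  | succ n =>
    rw [injective_iff_map_eq_zero]
    intro q hq
    obtain ⟨c, rfl⟩ := Submodule.mkQ_surjective _ q
    refine (Submodule.Quotient.mk_eq_zero _).2 ?_
    have : c ∈ LinearMap.ker (cousinD R F M n) := hq
    rw [hex n] at this
    exact this

theorem resolves_mk {F : ℕ → Set (PrimeSpectrum R)} {M : ModuleCat.{u} R}
    {P : ModuleCat.{u} R → Prop}
    (hfin : ∀ n, LinearMap.range (thetaFull R (F n \ F (n + 1)) (cousinK R F M n)) ≤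
      finSupp R (F n \ F (n + 1)) (cousinK R F M n))
    (hinj : ∀ n, Function.Injective (thetaFull R (F n \ F (n + 1)) (cousinK R F M n)))
    (hP : ∀ n, P (ModuleCat.of R (cousinC R F M n))) : CousinResolves R F M P := by
  refine ⟨hfin, hinj 0, fun n => ?_, hP⟩
  ext c
  rw [LinearMap.mem_ker]
  refine Iff.trans ?_ (Submodule.Quotient.mk_eq_zero _)
  exact map_eq_zero_iff _ (hinj (n + 1))

theorem resolves_tors (hπ : Function.Surjective π) (hker : ∀ r, π r = 0 ↔ ∃ s, r = x * s)
    (hx : x = 0 ∨ IsSMulRegular R x)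
    {F : ℕ → Set (PrimeSpectrum R)} {M : ModuleCat.{u} R}
    {F' : ℕ → Set (PrimeSpectrum R')} {M' : ModuleCat.{u} R'}
    (h : CousinResolves R F M (fun N => IsGorensteinInjective R N))
    (e : ℕ → ℕ) (he : ∀ n, e (n + 1) = e n + 1)
    (h0 : ∃ f : M' →+ cousinK R F M (e 0), TorsRel π x f)
    (hS : ∀ n p', p' ∈ F' n \ F' (n + 1) ↔ PrimeSpectrum.comap π p' ∈ F (e n) \ F (e n + 1))
    (hdiv : x = 0 ∨ ∀ n (k : cousinK R F M (e n)), ∃ k', x • k' = k) :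
    CousinResolves R' F' M' (fun N => IsGorensteinInjective R' N) := by
  have hdiv' : ∀ n, x = 0 ∨ ∀ k : cousinK R F M (e n), ∃ k', x • k' = k := fun n =>
    hdiv.imp id fun h => h n
  have key : ∀ n, ∃ f : cousinK R' F' M' n →+ cousinK R F M (e n), TorsRel π x f := by
    intro n
    induction n with
    | zero => exact h0
    | succ n ih =>
      obtain ⟨f, hf⟩ := ih
      obtain ⟨-, -, -, f1, hf1⟩ := nextK_tors hπ hker hf (F (e n) \ F (e n + 1))
        (F' n \ F' (n + 1)) (hS n) (h.1 (e n)) (theta_inj h (e n)) (hdiv' n)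
      rw [he]
      exact ⟨f1, hf1⟩
  refine resolves_mk ?_ ?_ ?_
  · intro n
    obtain ⟨f, hf⟩ := key n
    exact (nextK_tors hπ hker hf (F (e n) \ F (e n + 1))
        (F' n \ F' (n + 1)) (hS n) (h.1 (e n)) (theta_inj h (e n)) (hdiv' n)).1
  · intro n
    obtain ⟨f, hf⟩ := key n
    exact (nextK_tors hπ hker hf (F (e n) \ F (e n + 1))
        (F' n \ F' (n + 1)) (hS n) (h.1 (e n)) (theta_inj h (e n)) (hdiv' n)).2.1
  · intro n
    obtain ⟨f, hf⟩ := key n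
    obtain ⟨-, -, ⟨Φ, hΦ⟩, -⟩ := nextK_tors hπ hker hf (F (e n) \ F (e n + 1))
        (F' n \ F' (n + 1)) (hS n) (h.1 (e n)) (theta_inj h (e n)) (hdiv' n)
    exact gorInj_tors hπ hker hx hΦ (h.2.2.2 (e n))

variable {M M' : Type u} [AddCommGroup M] [Module R M] [AddCommGroup M'] [Module R' M']

theorem finite_target (hπ : Function.Surjective π)
    (g : M →+ M') (hg : ∀ r m, g (r • m) = π r • g m) (hgs : Function.Surjective g)
    [Module.Finite R M] : Module.Finite R' M' := by
  have : RingHomSurjective π := ⟨hπ⟩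
  let g' : M →ₛₗ[π] M' := { toFun := g, map_add' := map_add g, map_smul' := hg }
  exact Module.Finite.of_surjective g' hgs

theorem supp_iff (hπ : Function.Surjective π) (hx0 : π x = 0)
    (g : M →+ M') (hg : ∀ r m, g (r • m) = π r • g m) (hgs : Function.Surjective g)
    (hgk : ∀ m, g m = 0 ↔ ∃ m1, m = x • m1) [Module.Finite R M] (p' : PrimeSpectrum R') :
    p' ∈ Module.support R' M' ↔ PrimeSpectrum.comap π p' ∈ Module.support R M := by
  have := finite_target hπ g hg hgs
  constructor
  · rw [Module.mem_support_iff_of_finite, Module.mem_support_iff_of_finite]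
    intro h r hr
    apply h
    rw [Module.mem_annihilator] at hr ⊢
    intro m
    obtain ⟨m, rfl⟩ := hgs m
    rw [← hg, hr, map_zero]
  · intro h
    have h1 : PrimeSpectrum.comap π p' ∈ Module.support R (QuotSMulTop x M) := by
      rw [Module.support_quotSMulTop]
      refine ⟨h, ?_⟩
      rw [PrimeSpectrum.mem_zeroLocus, Set.singleton_subset_iff]
      change π x ∈ p'.asIdeal
      rw [hx0]
      exact zero_mem _
    rw [Module.mem_support_iff_of_finite] at h1 ⊢
    intro s hs
    obtain ⟨r, rfl⟩ := hπ s
    apply h1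
    rw [Module.mem_annihilator] at hs ⊢
    intro q
    obtain ⟨m, rfl⟩ := Submodule.mkQ_surjective _ q
    rw [← map_smul]
    refine (Submodule.Quotient.mk_eq_zero _).2 ?_
    have h2 := hs (g m)
    rw [← hg, hgk] at h2
    obtain ⟨m1, hm1⟩ := h2
    rw [hm1]
    exact Submodule.smul_mem_pointwise_smul _ _ _ trivial

theorem mem_heightFiltration (p : PrimeSpectrum R) (n : ℕ) :
    p ∈ heightFiltration R M n ↔ ∃ h : p ∈ Module.support R M,
      ∃ l : LTSeries (Module.support R M), l.last = ⟨p, h⟩ ∧ l.length = n := by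
  have hh : ∀ h : p ∈ Module.support R M, htM R M p = Order.height (⟨p, h⟩ : Module.support R M) := by
    intro h
    unfold htM
    rw [iSup_pos h]
  constructor
  · rintro ⟨h, hn⟩
    rw [hh h] at hn
    exact ⟨h, Order.exists_series_of_le_height _ hn⟩
  · rintro ⟨h, l, hl, rfl⟩
    refine ⟨h, ?_⟩
    rw [hh h, ← hl]
    exact Order.length_le_height_last

theorem comap_lt (hπ : Function.Surjective π) {p q : PrimeSpectrum R'} :
    PrimeSpectrum.comap π p < PrimeSpectrum.comap π q ↔ p < q := by
  have h : ∀ a b : PrimeSpectrum R', PrimeSpectrum.comap π a ≤ PrimeSpectrum.comap π b ↔ a ≤ b := by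
    intro a b
    constructor
    · intro h s hs
      obtain ⟨r, rfl⟩ := hπ s
      exact h hs
    · intro h r hr
      exact h hr
  rw [lt_iff_le_not_ge, lt_iff_le_not_ge, h, h]

theorem exists_comap (hπ : Function.Surjective π) (hker : ∀ r, π r = 0 ↔ ∃ s, r = x * s)
    (p : PrimeSpectrum R) (hxp : x ∈ p.asIdeal) : ∃ p', PrimeSpectrum.comap π p' = p := by
  have : p ∈ Set.range (PrimeSpectrum.comap π) := by
    rw [range_comap_of_surjective _ _ hπ]
    intro r hr
    obtain ⟨s, rfl⟩ := (hker r).1 hr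
    exact Ideal.mul_mem_right _ _ hxp
  exact this

/-- Transfer the strictly increasing chains. -/
theorem map_series {α β : Type*} [Preorder α] [Preorder β] (l : LTSeries α) (f : α → β)
    (hf : StrictMono f) :
    ∃ l' : LTSeries β, l'.last = f l.last ∧ l'.head = f l.head ∧ l'.length = l.length :=
  ⟨l.map f hf, rfl, rfl, rfl⟩

theorem filt_zero (hπ : Function.Surjective π) (hker : ∀ r, π r = 0 ↔ ∃ s, r = x * s)
    (hx : x = 0)
    (g : M →+ M') (hg : ∀ r m, g (r • m) = π r • g m) (hgs : Function.Surjective g)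
    (hgk : ∀ m, g m = 0 ↔ ∃ m1, m = x • m1) [Module.Finite R M] (p' : PrimeSpectrum R') (n : ℕ) :
    p' ∈ heightFiltration R' M' n ↔ PrimeSpectrum.comap π p' ∈ heightFiltration R M n := by
  have hx0 : π x = 0 := (hker x).2 ⟨1, by simp⟩
  have hcinj : Function.Injective (PrimeSpectrum.comap π) :=
    PrimeSpectrum.comap_injective_of_surjective π hπ
  have hs := supp_iff hπ hx0 g hg hgs hgk
  rw [mem_heightFiltration, mem_heightFiltration]
  constructor
  · rintro ⟨h, l, hl, hn⟩
    obtain ⟨q, hq1, -, hq3⟩ := map_series (β := Module.support R M) l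
      (fun q => ⟨PrimeSpectrum.comap π q.1, (hs _).1 q.2⟩)
      (by intro a b hab; exact (comap_lt hπ).2 hab)
    refine ⟨(hs p').1 h, q, ?_, hq3.trans hn⟩
    rw [hq1, hl]
  · rintro ⟨h, l, hl, hn⟩
    choose ψ hψ using fun q : Module.support R M =>
      exists_comap hπ hker q.1 (by rw [hx]; exact zero_mem _)
    obtain ⟨q, hq1, -, hq3⟩ := map_series (β := Module.support R' M') l
      (fun q => ⟨ψ q, (hs _).2 (by rw [hψ]; exact q.2)⟩)
      (by intro a b hab; exact (comap_lt hπ).1 (by rw [hψ, hψ]; exact hab))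
    refine ⟨(hs p').2 h, q, ?_, hq3.trans hn⟩
    rw [hq1, hl]
    exact Subtype.ext (hcinj (hψ _))

theorem filt_succ [IsNoetherianRing R]
    (hπ : Function.Surjective π) (hker : ∀ r, π r = 0 ↔ ∃ s, r = x * s)
    (hx : IsSMulRegular M x)
    (g : M →+ M') (hg : ∀ r m, g (r • m) = π r • g m) (hgs : Function.Surjective g)
    (hgk : ∀ m, g m = 0 ↔ ∃ m1, m = x • m1) [Module.Finite R M] (p' : PrimeSpectrum R') (n : ℕ) :
    p' ∈ heightFiltration R' M' n ↔ PrimeSpectrum.comap π p' ∈ heightFiltration R M (n + 1) := by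
  have hx0 : π x = 0 := (hker x).2 ⟨1, by simp⟩
  have hcinj : Function.Injective (PrimeSpectrum.comap π) :=
    PrimeSpectrum.comap_injective_of_surjective π hπ
  have hs := supp_iff hπ hx0 g hg hgs hgk
  have hxm : ∀ q : PrimeSpectrum R', x ∈ (PrimeSpectrum.comap π q).asIdeal := by
    intro q
    change π x ∈ q.asIdeal
    rw [hx0]
    exact zero_mem _
  rw [mem_heightFiltration, mem_heightFiltration]
  constructor
  · rintro ⟨h, l, hl, hn⟩
    obtain ⟨q, hq1, hq2, hq3⟩ := map_series (β := Module.support R M) l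
      (fun q => ⟨PrimeSpectrum.comap π q.1, (hs _).1 q.2⟩)
      (by intro a b hab; exact (comap_lt hπ).2 hab)
    have hqh : x ∈ q.head.1.asIdeal := by
      rw [hq2]
      exact hxm _
    obtain ⟨r, hrm, hr⟩ := Ideal.exists_minimalPrimes_le
      (Module.mem_support_iff_of_finite.mp q.head.2)
    let r' : Module.support R M :=
      ⟨⟨r, hrm.isPrime⟩, Module.mem_support_iff_of_finite.mpr hrm.1.2⟩
    have hr' : r' < q.head := lt_of_le_of_ne hr (fun h => by
      have h1 : x ∈ r'.1.asIdeal := by rw [h]; exact hqh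
      exact hx.notMem_of_mem_minimalPrimes hrm h1)
    refine ⟨(hs p').1 h, q.cons r' hr', ?_, ?_⟩
    · rw [RelSeries.last_cons, hq1, hl]
    · simp [hq3, hn]
  · rintro ⟨h, l, hl, hn⟩
    obtain ⟨l', hl1, hl2, hl3⟩ := map_series (β := PrimeSpectrum R) l Subtype.val
      (by intro a b hab; exact hab)
    rw [hl] at hl1
    obtain ⟨q, hxq, hq, h0, h1⟩ := PrimeSpectrum.exist_ltSeries_mem_one_of_mem_last
      l' (x := x) (by rw [hl1]; exact hxm _)
    have hqn : q.length = n + 1 := by rw [← hq, hl3, ← hn]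
    rw [hl1] at h1
    rw [hl2] at h0
    have hqs : ∀ i, q i ∈ Module.support R M := fun i =>
      Module.mem_support_mono (q.monotone (Fin.zero_le i) : q.head ≤ q i)
        (by change q.head ∈ _; rw [← h0]; exact l.head.2)
    have hqx : ∀ i : Fin (n + 1), x ∈ (q ⟨i.1 + 1, by omega⟩).asIdeal := by
      intro i
      refine q.monotone ?_ hxq
      rw [Fin.le_def, Fin.val_one']
      exact (Nat.mod_le _ _).trans (by simp)
    choose ψ hψ using fun i => exists_comap hπ hker _ (hqx i)
    refine ⟨(hs p').2 h, ⟨n, fun i => ⟨ψ i, (hs _).2 (by rw [hψ]; exact hqs _)⟩, ?_⟩, ?_, rfl⟩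
    · intro i
      change ψ _ < ψ _
      rw [← comap_lt hπ, hψ, hψ]
      apply q.strictMono
      simp [Fin.lt_def]
    · refine Subtype.ext (hcinj ?_)
      change PrimeSpectrum.comap π (ψ (Fin.last n)) = PrimeSpectrum.comap π p'
      refine (hψ _).trans (Eq.trans ?_ h1.symm)
      rw [RelSeries.last]
      congr 1
      ext
      simp [hqn]

end

theorem main_step {R R' : Type u} [CommRing R] [CommRing R'] [IsNoetherianRing R] (π : R →+* R')
    (x : R) (hπ : Function.Surjective π) (hker : ∀ r, π r = 0 ↔ ∃ s, r = x * s)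
    (M : ModuleCat.{u} R) (M' : ModuleCat.{u} R')
    (g : M →+ M') (hg : ∀ r m, g (r • m) = π r • g m) (hgs : Function.Surjective g)
    (hgk : ∀ m, g m = 0 ↔ ∃ m1 : M, m = x • m1)
    (hx : x = 0 ∨ (IsSMulRegular R x ∧ IsSMulRegular M x))
    (hM : IsGGorenstein R M) (hM' : ∃ m : M', m ≠ 0) : IsGGorenstein R' M' := by
  obtain ⟨-, hfin, hres⟩ := hM
  refine ⟨hM', finite_target hπ g hg hgs, ?_⟩
  rcases hx with hx | ⟨hxR, hxM⟩
  · refine resolves_tors hπ hker (Or.inl hx) hres id (fun _ => rfl) ?_ ?_ (Or.inl hx)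
    · have hbij : Function.Bijective g := by
        refine ⟨(injective_iff_map_eq_zero g).2 fun m hm => ?_, hgs⟩
        obtain ⟨m1, rfl⟩ := (hgk m).1 hm
        rw [hx, zero_smul]
      let e : M ≃+ M' := AddEquiv.ofBijective g hbij
      refine ⟨(e.symm.toAddMonoidHom : M' →+ M), ⟨?_, e.symm.injective, ?_⟩⟩
      · intro r k
        apply e.injective
        change e (e.symm (π r • k)) = g (r • e.symm k)
        rw [hg]
        change _ = π r • e (e.symm k)
        rw [e.apply_symm_apply, e.apply_symm_apply]
      · intro k _
        exact ⟨e k, e.symm_apply_apply k⟩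
    · intro n p'
      rw [Set.mem_diff, Set.mem_diff, filt_zero hπ hker hx g hg hgs hgk,
        filt_zero hπ hker hx g hg hgs hgk]
      rfl
  · have hdiv : ∀ n (k : cousinK R (heightFiltration R M) M (n + 1)), ∃ k', x • k' = k := by
      intro n k
      obtain ⟨c, rfl⟩ := Submodule.mkQ_surjective _ k
      obtain ⟨c', rfl⟩ := gorInj_div (hres.2.2.2 n) hxR c
      exact ⟨Submodule.mkQ _ c', (map_smul _ x c').symm⟩
    refine resolves_tors hπ hker (Or.inr hxR) hres (fun n => n + 1) (fun _ => rfl) ?_ ?_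
      (Or.inr hdiv)
    · exact base_tors g hg hgs hgk hxM _ (hres.1 0) (theta_inj hres 0)
        (gorInj_div (hres.2.2.2 0) hxR)
    · intro n p'
      rw [Set.mem_diff, Set.mem_diff, filt_succ hπ hker hxM g hg hgs hgk,
        filt_succ hπ hker hxM g hg hgs hgk]

theorem quot_step {R : Type u} [CommRing R] [IsNoetherianRing R] (M : ModuleCat.{u} R)
    (J J' : Ideal R) (x : R) (hJ : J' = J ⊔ Ideal.span {x})
    (hx : x = 0 ∨ (IsSMulRegular (R ⧸ J) x ∧ IsSMulRegular (M ⧸ (J • (⊤ : Submodule R M))) x))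
    (h : IsGGorenstein (R ⧸ J) (ModuleCat.of (R ⧸ J) (M ⧸ (J • (⊤ : Submodule R M)))))
    (hne : ∃ m : M ⧸ (J' • (⊤ : Submodule R M)), m ≠ 0) :
    IsGGorenstein (R ⧸ J') (ModuleCat.of (R ⧸ J') (M ⧸ (J' • (⊤ : Submodule R M)))) := by
  have hle : J ≤ J' := hJ ▸ le_sup_left
  have hle2 : J • (⊤ : Submodule R M) ≤ J' • (⊤ : Submodule R M) := Submodule.smul_mono_left hle
  have hmem : ∀ r, r ∈ J' ↔ ∃ s, r - x * s ∈ J := by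
    intro r
    rw [hJ, Submodule.mem_sup]
    constructor
    · rintro ⟨y, hy, z, hz, rfl⟩
      obtain ⟨s, rfl⟩ := Ideal.mem_span_singleton'.1 hz
      exact ⟨s, by rw [mul_comm]; simpa using hy⟩
    · rintro ⟨s, hs⟩
      exact ⟨_, hs, x * s, Ideal.mem_span_singleton'.2 ⟨s, mul_comm _ _⟩, by ring⟩
  have hmemM : ∀ m : M, m ∈ J' • (⊤ : Submodule R M) ↔
      ∃ s, m - x • s ∈ J • (⊤ : Submodule R M) := by
    intro m
    rw [hJ, Submodule.sup_smul, Submodule.mem_sup]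
    constructor
    · rintro ⟨y, hy, z, hz, rfl⟩
      rw [Submodule.ideal_span_singleton_smul] at hz
      obtain ⟨s, -, rfl⟩ := (Submodule.mem_smul_pointwise_iff_exists _ _ _).1 hz
      exact ⟨s, by simpa using hy⟩
    · rintro ⟨s, hs⟩
      exact ⟨_, hs, x • s, Submodule.smul_mem_smul (Ideal.mem_span_singleton_self x) trivial,
        by simp⟩
  refine main_step (Ideal.Quotient.factor hle) (Ideal.Quotient.mk J x)
    (Ideal.Quotient.factor_surjective hle) ?_ _ _
    ((Submodule.factor hle2).toAddMonoidHom) ?_ (Submodule.factor_surjective hle2) ?_ ?_ h hne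
  · intro r
    obtain ⟨r, rfl⟩ := Ideal.Quotient.mk_surjective r
    rw [Ideal.Quotient.factor_mk, Ideal.Quotient.eq_zero_iff_mem, hmem]
    constructor
    · rintro ⟨s, hs⟩
      exact ⟨Ideal.Quotient.mk J s, by rw [← map_mul]; exact (Ideal.Quotient.mk_eq_mk_iff_sub_mem _ _).2 hs⟩
    · rintro ⟨s, hs⟩
      obtain ⟨s, rfl⟩ := Ideal.Quotient.mk_surjective s
      rw [← map_mul] at hs
      exact ⟨s, (Ideal.Quotient.mk_eq_mk_iff_sub_mem _ _).1 hs⟩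
  · intro r m
    obtain ⟨r, rfl⟩ := Ideal.Quotient.mk_surjective r
    obtain ⟨m, rfl⟩ := Submodule.mkQ_surjective _ m
    rfl
  · intro m
    obtain ⟨m, rfl⟩ := Submodule.mkQ_surjective _ m
    refine (Submodule.Quotient.mk_eq_zero (J' • (⊤ : Submodule R M)) (x := m)).trans ?_
    rw [hmemM]
    constructor
    · rintro ⟨s, hs⟩
      exact ⟨Submodule.mkQ _ s, (Submodule.Quotient.eq _).2 hs⟩
    · rintro ⟨s, hs⟩
      obtain ⟨s, rfl⟩ := Submodule.mkQ_surjective _ s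
      exact ⟨s, (Submodule.Quotient.eq _).1 hs⟩
  · rcases hx with hx | ⟨h1, h2⟩
    · exact Or.inl (by rw [hx, map_zero])
    · refine Or.inr ⟨fun a b hab => h1 ?_, fun a b hab => h2 ?_⟩
      · have := hab
        simp only [smul_eq_mul] at this
        simpa [Algebra.smul_def] using this
      · obtain ⟨a, rfl⟩ := Submodule.mkQ_surjective _ a
        obtain ⟨b, rfl⟩ := Submodule.mkQ_surjective _ b
        exact hab

theorem quot_bot {R : Type u} [CommRing R] [IsNoetherianRing R] (M : ModuleCat.{u} R)
    (J' : Ideal R) (hJ : J' = ⊥) (h : IsGGorenstein R M) :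
    IsGGorenstein (R ⧸ J') (ModuleCat.of (R ⧸ J') (M ⧸ (J' • (⊤ : Submodule R M)))) := by
  obtain ⟨m, hm⟩ := h.1
  have hb : J' • (⊤ : Submodule R M) = ⊥ := by rw [hJ, Submodule.bot_smul]
  refine main_step (Ideal.Quotient.mk J') 0 Ideal.Quotient.mk_surjective ?_ M _
    ((Submodule.mkQ (J' • (⊤ : Submodule R M))).toAddMonoidHom) (fun _ _ => rfl)
    (Submodule.mkQ_surjective _) ?_ (Or.inl rfl) h ⟨Submodule.mkQ _ m, ?_⟩
  · intro r
    rw [Ideal.Quotient.eq_zero_iff_mem, hJ]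
    simp
  · intro m
    refine (Submodule.Quotient.mk_eq_zero (J' • (⊤ : Submodule R M)) (x := m)).trans ?_
    rw [hb]
    simp
  · intro h0
    have := (Submodule.Quotient.mk_eq_zero (J' • (⊤ : Submodule R M)) (x := m)).1 h0
    rw [hb] at this
    exact hm (by simpa using this)

theorem main_list {R : Type u} [CommRing R] [IsNoetherianRing R] (M : ModuleCat.{u} R)
    (hM : IsGGorenstein R M) (xs : List R)
    (hxM : RingTheory.Sequence.IsWeaklyRegular M xs)
    (hxR : RingTheory.Sequence.IsWeaklyRegular R xs)
    (hne : ∃ m : M ⧸ (Ideal.ofList xs • (⊤ : Submodule R M)), m ≠ 0) :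
    IsGGorenstein (R ⧸ Ideal.ofList xs)
      (ModuleCat.of (R ⧸ Ideal.ofList xs) (M ⧸ (Ideal.ofList xs • (⊤ : Submodule R M)))) := by
  induction xs using List.reverseRecOn with
  | nil => exact quot_bot M _ Ideal.ofList_nil hM
  | append_singleton xs x ih =>
    rw [RingTheory.Sequence.isWeaklyRegular_append_iff,
      RingTheory.Sequence.isWeaklyRegular_singleton_iff] at hxM hxR
    have hJ : Ideal.ofList (xs ++ [x]) = Ideal.ofList xs ⊔ Ideal.span {x} := by
      rw [Ideal.ofList_append, Ideal.ofList_singleton]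
    refine quot_step M _ _ x hJ (Or.inr ⟨?_, hxM.2⟩) (ih hxM.1 hxR.1 ?_) hne
    · have h2 := hxR.2
      have e : Ideal.ofList xs • (⊤ : Submodule R R) = Ideal.ofList xs := by
        rw [smul_eq_mul, Ideal.mul_top]
      rw [e] at h2
      exact h2
    · obtain ⟨m, hm⟩ := hne
      obtain ⟨m, rfl⟩ := Submodule.mkQ_surjective _ m
      refine ⟨Submodule.mkQ _ m, fun h0 => hm ?_⟩
      have h1 := (Submodule.Quotient.mk_eq_zero _ (x := m)).1 h0
      refine (Submodule.Quotient.mk_eq_zero _ (x := m)).2 ?_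
      exact Submodule.smul_mono_left (hJ ▸ le_sup_left) h1

end GGProof

open GG in
/-- G–Gorenstein modules specialize: quotients by sequences regular on both `M` and `R`
remain G–Gorenstein. -/
theorem stmt4 (R : Type u) [CommRing R] [IsNoetherianRing R] (hR : HasDualizingComplex R)
    (M : ModuleCat.{u} R) (hM : IsGGorenstein R M) (xs : List R)
    (hxM : RingTheory.Sequence.IsRegular M xs)
    (hxR : RingTheory.Sequence.IsRegular R xs) :
    IsGGorenstein (R ⧸ Ideal.span {r | r ∈ xs})
      (ModuleCat.of (R ⧸ Ideal.span {r | r ∈ xs})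
        (M ⧸ (Ideal.span {r | r ∈ xs} • (⊤ : Submodule R M)))) := by
  refine GGProof.main_list M hM xs hxM.toIsWeaklyRegular hxR.toIsWeaklyRegular ?_
  by_contra hcon
  push Not at hcon
  refine hxM.top_ne_smul (eq_comm.1 (Submodule.eq_top_iff'.2 fun m => ?_))
  exact (Submodule.Quotient.mk_eq_zero _ (x := m)).1 (hcon _)
end
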